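/- arXiv:1206.2272 — 4 statements merged into one kernel-verified Lean document; each statement's English description precedes it below -/
import Mathlib

section
/- The set Γ = ⋃_{n≥2} { γ ∈ ℝ : 0 < γ < π/2 and tan(nγ) = n·tan(γ) } is dense in the interval (0, π/2): for all real a, b with 0 ≤ a < b ≤ π/2 there exists γ ∈ Γ with a < γ < b. -/
open Real

/-- The set `Γ = ⋃_{n ≥ 2} {γ : 0 < γ < π/2, tan (n γ) = n tan γ}`. -/
noncomputable def GammaSet : Set ℝ :=
  ⋃ n ∈ {n : ℕ | 2 ≤ n},
    {γ : ℝ | 0 < γ ∧ γ < π / 2 ∧ Real.tan (n * γ) = n * Real.tan γ}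

/-- Between consecutive multiples of `π / n` inside `(0, π / 2)` there is a solution of
`tan (n γ) = n tan γ`. -/
theorem exists_tan_nat_mul_eq {n : ℕ} (hn : 0 < n) (k : ℕ)
    (h0 : 0 < k * π / n) (h1 : (k + 1) * π / n < π / 2) :
    ∃ γ ∈ Set.Icc (k * π / n) ((k + 1) * π / n), tan (n * γ) = n * tan γ := by
  have hn' : (0 : ℝ) < n := by exact_mod_cast hn
  have hle : k * π / n ≤ (k + 1) * π / n := by
    gcongr
    linarith
  have hpi := pi_pos
  let g : ℝ → ℝ := fun x => (-1) ^ k * (sin (n * x) * cos x - n * sin x * cos (n * x))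
  have hg : ContinuousOn g (Set.Icc (k * π / n) ((k + 1) * π / n)) := by
    fun_prop
  have hsq : ((-1 : ℝ)) ^ k * (-1) ^ k = 1 := by
    rw [← mul_pow]
    simp
  have hleft : g (k * π / n) ≤ 0 := by
    have hs : 0 ≤ sin (k * π / n) := sin_nonneg_of_nonneg_of_le_pi h0.le (by linarith)
    have hm : (n : ℝ) * (k * π / n) = k * π := by field_simp
    have : g (k * π / n) = -(n * sin (k * π / n)) := by
      simp only [g, hm, sin_nat_mul_pi, cos_nat_mul_pi]
      linear_combination (-(n * sin (k * π / n))) * hsq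
    rw [this]
    have := mul_nonneg hn'.le hs
    linarith
  have hright : 0 ≤ g ((k + 1) * π / n) := by
    have hs : 0 ≤ sin ((k + 1) * π / n) :=
      sin_nonneg_of_nonneg_of_le_pi (by linarith) (by linarith)
    have hm : (n : ℝ) * ((k + 1) * π / n) = (k + 1 : ℕ) * π := by
      push_cast
      field_simp
    have : g ((k + 1) * π / n) = n * sin ((k + 1) * π / n) := by
      simp only [g, hm, sin_nat_mul_pi, cos_nat_mul_pi, pow_succ]
      linear_combination (n * sin ((k + 1) * π / n)) * hsq
    rw [this]
    exact mul_nonneg hn'.le hs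
  obtain ⟨x, hx, hgx⟩ := intermediate_value_Icc hle hg ⟨hleft, hright⟩
  refine ⟨x, hx, ?_⟩
  have hf : sin (n * x) * cos x - n * sin x * cos (n * x) = 0 :=
    (mul_eq_zero.mp hgx).resolve_left (pow_ne_zero _ (by norm_num))
  have hc : cos x ≠ 0 := (cos_pos_of_mem_Ioo ⟨by linarith [hx.1], by linarith [hx.2]⟩).ne'
  have hcn : cos (n * x) ≠ 0 := by
    intro h
    have hs : sin (n * x) = 0 := by simpa [h, hc] using hf
    simpa [h, hs] using sin_sq_add_cos_sq (n * x)
  rw [tan_eq_sin_div_cos, tan_eq_sin_div_cos]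
  field_simp
  linarith

/-- the set `Γ` is dense in `(0, π/2)`. -/
theorem Gamma_dense :
    ∀ a b : ℝ, 0 ≤ a → a < b → b ≤ π / 2 → ∃ γ ∈ GammaSet, a < γ ∧ γ < b := by
  intro a b ha hab hb
  have hpi := pi_pos
  obtain ⟨m, hm⟩ := exists_nat_gt (2 * π / (b - a))
  set n : ℕ := m + 2 with hn
  have hn' : (0 : ℝ) < n := by positivity
  have hlen : 2 * π / n < b - a := by
    rw [div_lt_iff₀ (sub_pos.mpr hab)] at hm
    rw [div_lt_iff₀ hn', hn]
    push_cast
    nlinarith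
  set k : ℕ := ⌊a * n / π⌋₊ + 1 with hk
  have hak : a < k * π / n := by
    have := Nat.lt_floor_add_one (a * n / π)
    rw [div_lt_iff₀ hpi] at this
    rw [lt_div_iff₀ hn', hk]
    exact_mod_cast this
  have hkb : (k + 1) * π / n < b := by
    have := Nat.floor_le (show 0 ≤ a * n / π by positivity)
    rw [le_div_iff₀ hpi] at this
    rw [div_lt_iff₀ hn'] at hlen ⊢
    rw [hk]
    push_cast
    nlinarith
  obtain ⟨γ, hγ, htan⟩ := exists_tan_nat_mul_eq (n := n) (by omega) k (by linarith) (by linarith)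
  have haγ : a < γ := hak.trans_le hγ.1
  have hγb : γ < b := hγ.2.trans_lt hkb
  refine ⟨γ, ?_, haγ, hγb⟩
  simp only [GammaSet, Set.mem_iUnion]
  exact ⟨n, Nat.le_add_left 2 m, by linarith, by linarith, htan⟩
end

section
/- Let Ω ⊂ ℝ² be a compact strictly convex body with nonempty interior whose boundary admits a C¹ arclength parametrization c of period L, and let γ ∈ (0, π/2). Then there exist at least four directed chords of Ω making angle γ with the boundary at both endpoints and having pairwise distinct directions: there are pairs (s₁,t₁),…,(s₄,t₄) with c(sᵢ) ≠ c(tᵢ), ∠(c(tᵢ)−c(sᵢ), c'(sᵢ)) = γ and ∠(c(tᵢ)−c(sᵢ), c'(tᵢ)) = γ for each i, and the unit vectors (c(tᵢ)−c(sᵢ))/‖c(tᵢ)−c(sᵢ)‖ are pairwise distinct. -/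
open Real InnerProductGeometry

/-- The plane `ℝ²`. -/
abbrev Plane := EuclideanSpace ℝ (Fin 2)

/-- `c : ℝ → ℝ²` is a `C¹` arclength parametrization, of period `L`, of the
boundary of the plane body `Ω`. -/
structure IsArclengthParam (Ω : Set Plane) (c : ℝ → Plane) (L : ℝ) : Prop where
  hL : 0 < L
  contDiff : ContDiff ℝ 1 c
  unitSpeed : ∀ s, ‖deriv c s‖ = 1
  periodic : Function.Periodic c L
  injOn : Set.InjOn c (Set.Ico 0 L)
  range_eq : Set.range c = frontier Ω

section FourZeros

/-- A continuous function without zeros on an open interval has constant sign there. -/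
lemma exists_sign_of_ne_zero {f : ℝ → ℝ} (hf : Continuous f) {a b : ℝ}
    (h : ∀ x ∈ Set.Ioo a b, f x ≠ 0) :
    ∃ σ : ℝ, (σ = 1 ∨ σ = -1) ∧ ∀ x ∈ Set.Ioo a b, 0 < f x * σ := by
  by_cases hpos : ∀ x ∈ Set.Ioo a b, 0 < f x
  · exact ⟨1, .inl rfl, by simpa using hpos⟩
  refine ⟨-1, .inr rfl, ?_⟩
  push Not at hpos
  obtain ⟨x, hx, hfx⟩ := hpos
  by_contra! hcon
  obtain ⟨y, hy, hfy⟩ := hcon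
  obtain ⟨z, hz, hfz⟩ :=
    isPreconnected_Ioo.intermediate_value hx hy hf.continuousOn ⟨hfx, by linarith⟩
  exact h z hz hfz

lemma integral_mul_ne_zero_of_pos {f g : ℝ → ℝ} (hf : Continuous f) (hg : Continuous g)
    {a b c d : ℝ} (had : a < d) (hab : a ≤ b) (hbc : b ≤ c) (hcd : c < d)
    (hd : f d = 0) (hb : f b = 0) (hc : f c = 0)
    (h₁ : ∀ x ∈ Set.Ioo a b, 0 < f x * g x) (h₂ : ∀ x ∈ Set.Ioo b c, 0 < f x * g x)
    (h₃ : ∀ x ∈ Set.Ioo c d, 0 < f x * g x) :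
    ∫ x in a..d, f x * g x ≠ 0 := by
  refine (intervalIntegral.integral_pos had (hf.mul hg).continuousOn ?_
    ⟨(c + d) / 2, ⟨by linarith, by linarith⟩, h₃ _ ⟨by linarith, by linarith⟩⟩).ne'
  rintro x ⟨hax, hxd⟩
  rcases lt_trichotomy x b with hxb | rfl | hxb
  · exact (h₁ x ⟨hax, hxb⟩).le
  · simp [hb]
  rcases lt_trichotomy x c with hxc | rfl | hxc
  · exact (h₂ x ⟨hxb, hxc⟩).le
  · simp [hc]
  rcases hxd.lt_or_eq with hxd | rfl
  · exact (h₃ x ⟨hxc, hxd⟩).le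
  · simp [hd]

/-- The trigonometric polynomial of degree one with zeros at `u` and `v`. -/
lemma sin_half_mul_sin_half (u v x : ℝ) :
    sin ((x - u) / 2) * sin ((x - v) / 2) =
      cos ((u - v) / 2) / 2 + (-cos ((u + v) / 2) / 2) * cos x
        + (-sin ((u + v) / 2) / 2) * sin x := by
  have h₁ : cos ((u - v) / 2) = cos ((x - u) / 2 - (x - v) / 2) := by
    rw [← cos_neg]; ring_nf
  have h₂ : cos ((x - u) / 2 + (x - v) / 2) = cos (x - (u + v) / 2) := by ring_nf
  rw [cos_sub] at h₁
  rw [cos_add, cos_sub x] at h₂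
  linarith

lemma sin_half_pos {x : ℝ} (h₀ : 0 < x) (h₁ : x < 2 * π) : 0 < sin (x / 2) :=
  sin_pos_of_pos_of_lt_pi (by linarith) (by linarith)

lemma sin_half_neg {x : ℝ} (h₀ : x < 0) (h₁ : -(2 * π) < x) : sin (x / 2) < 0 :=
  sin_neg_of_neg_of_neg_pi_lt (by linarith) (by linarith)

/-- If `f` is orthogonal to all trigonometric polynomials of degree at most one, three zeros
in a period never exhaust its zeros. -/
lemma exists_zero_ne_of_orthogonal {f : ℝ → ℝ} (hf : Continuous f)
    (hper : Function.Periodic f (2 * π))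
    (horth : ∀ a p q r : ℝ,
      ∫ x in a..a + 2 * π, f x * (p + q * cos x + r * sin x) = 0)
    {a b c : ℝ} (hab : a ≤ b) (hbc : b ≤ c) (hca : c < a + 2 * π)
    (ha : f a = 0) (hb : f b = 0) (hc : f c = 0) :
    ∃ d ∈ Set.Ioo a (a + 2 * π), d ≠ b ∧ d ≠ c ∧ f d = 0 := by
  by_contra! hcon
  have hd : f (a + 2 * π) = 0 := by rw [hper, ha]
  have hπ := pi_pos
  have key : ∀ g : ℝ → ℝ, (∃ p q r : ℝ, ∀ x, g x = p + q * cos x + r * sin x) →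
      (∀ x ∈ Set.Ioo a b, 0 < f x * g x) → (∀ x ∈ Set.Ioo b c, 0 < f x * g x) →
      (∀ x ∈ Set.Ioo c (a + 2 * π), 0 < f x * g x) → False := by
    rintro g ⟨p, q, r, hg⟩ h₁ h₂ h₃
    obtain rfl : g = fun x => p + q * cos x + r * sin x := funext hg
    exact integral_mul_ne_zero_of_pos hf (by fun_prop) (by linarith) hab hbc hca hd hb hc
      h₁ h₂ h₃ (horth a p q r)
  have hsin : ∀ σ u v : ℝ, ∃ p q r : ℝ, ∀ x,
      σ * (sin ((x - u) / 2) * sin ((x - v) / 2)) = p + q * cos x + r * sin x := by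
    intro σ u v
    refine ⟨σ * (cos ((u - v) / 2) / 2), σ * (-cos ((u + v) / 2) / 2),
      σ * (-sin ((u + v) / 2) / 2), fun x => ?_⟩
    rw [sin_half_mul_sin_half]
    ring
  have hone : ∀ σ : ℝ, ∃ p q r : ℝ, ∀ x : ℝ, (fun _ => σ) x = p + q * cos x + r * sin x :=
    fun σ => ⟨σ, 0, 0, fun x => by simp⟩
  obtain ⟨σ₁, e₁, s₁⟩ := exists_sign_of_ne_zero hf (a := a) (b := b) fun x hx =>
    hcon x ⟨hx.1, by linarith [hx.2]⟩ hx.2.ne (by linarith [hx.2] : x < c).ne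
  obtain ⟨σ₂, e₂, s₂⟩ := exists_sign_of_ne_zero hf (a := b) (b := c) fun x hx =>
    hcon x ⟨by linarith [hx.1], by linarith [hx.2]⟩ hx.1.ne' hx.2.ne
  obtain ⟨σ₃, e₃, s₃⟩ := exists_sign_of_ne_zero hf (a := c) (b := a + 2 * π) fun x hx =>
    hcon x ⟨by linarith [hx.1], hx.2⟩ (by linarith [hx.1] : b < x).ne' hx.1.ne'
  have pos : ∀ u x : ℝ, u < x → x < u + 2 * π → 0 < sin ((x - u) / 2) := fun u x h h' =>
    sin_half_pos (by linarith) (by linarith)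
  have neg : ∀ u x : ℝ, x < u → u < x + 2 * π → 0 < -sin ((x - u) / 2) := fun u x h h' =>
    neg_pos.2 (sin_half_neg (by linarith) (by linarith))
  have hsigns : (σ₁ = σ₂ ∧ σ₂ = σ₃) ∨ (σ₁ = σ₂ ∧ σ₃ = -σ₂) ∨ (σ₂ = σ₃ ∧ σ₁ = -σ₃) ∨
      (σ₁ = σ₃ ∧ σ₂ = -σ₃) := by
    rcases e₁ with rfl | rfl <;> rcases e₂ with rfl | rfl <;> rcases e₃ with rfl | rfl <;>
      norm_num
  rcases hsigns with ⟨rfl, rfl⟩ | ⟨rfl, rfl⟩ | ⟨rfl, rfl⟩ | ⟨rfl, rfl⟩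
  · exact key _ (hone σ₁) s₁ s₂ s₃
  · refine key _ (hsin (-σ₁) a c) ?_ ?_ ?_ <;> rintro x ⟨hx, hx'⟩
    · linarith [mul_pos (s₁ x ⟨hx, hx'⟩)
        (mul_pos (pos a x (by linarith) (by linarith)) (neg c x (by linarith) (by linarith)))]
    · linarith [mul_pos (s₂ x ⟨hx, hx'⟩)
        (mul_pos (pos a x (by linarith) (by linarith)) (neg c x (by linarith) (by linarith)))]
    · linarith [mul_pos (s₃ x ⟨hx, hx'⟩)
        (mul_pos (pos a x (by linarith) (by linarith)) (pos c x (by linarith) (by linarith)))]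
  · refine key _ (hsin σ₂ a b) ?_ ?_ ?_ <;> rintro x ⟨hx, hx'⟩
    · linarith [mul_pos (s₁ x ⟨hx, hx'⟩)
        (mul_pos (pos a x (by linarith) (by linarith)) (neg b x (by linarith) (by linarith)))]
    · linarith [mul_pos (s₂ x ⟨hx, hx'⟩)
        (mul_pos (pos a x (by linarith) (by linarith)) (pos b x (by linarith) (by linarith)))]
    · linarith [mul_pos (s₃ x ⟨hx, hx'⟩)
        (mul_pos (pos a x (by linarith) (by linarith)) (pos b x (by linarith) (by linarith)))]
  · refine key _ (hsin σ₁ b c) ?_ ?_ ?_ <;> rintro x ⟨hx, hx'⟩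
    · linarith [mul_pos (s₁ x ⟨hx, hx'⟩)
        (mul_pos (neg b x (by linarith) (by linarith)) (neg c x (by linarith) (by linarith)))]
    · linarith [mul_pos (s₂ x ⟨hx, hx'⟩)
        (mul_pos (pos b x (by linarith) (by linarith)) (neg c x (by linarith) (by linarith)))]
    · linarith [mul_pos (s₃ x ⟨hx, hx'⟩)
        (mul_pos (pos b x (by linarith) (by linarith)) (pos c x (by linarith) (by linarith)))]

/-- A Sturm–Hurwitz theorem: a continuous periodic function orthogonal to all trigonometric
polynomials of degree at most one has at least four zeros in some period. -/
lemma exists_four_zeros_of_orthogonal {f : ℝ → ℝ} (hf : Continuous f)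
    (hper : Function.Periodic f (2 * π))
    (horth : ∀ a p q r : ℝ,
      ∫ x in a..a + 2 * π, f x * (p + q * cos x + r * sin x) = 0) :
    ∃ (a : ℝ) (z : Fin 4 → ℝ), Function.Injective z ∧
      (∀ i, z i ∈ Set.Ico a (a + 2 * π)) ∧ ∀ i, f (z i) = 0 := by
  have hπ := pi_pos
  obtain ⟨a, ha⟩ : ∃ a, f a = 0 := by
    by_contra! hcon
    obtain ⟨σ, -, hσ⟩ :=
      exists_sign_of_ne_zero hf (a := 0 - 1) (b := 0 + 2 * π + 1) fun x _ => hcon x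
    refine (intervalIntegral.integral_pos (by linarith : (0 : ℝ) < 0 + 2 * π)
      (f := fun x => f x * (σ + 0 * cos x + 0 * sin x)) (by fun_prop) (fun x hx => ?_)
      ⟨π, ⟨by linarith, by linarith⟩, ?_⟩).ne' (horth 0 σ 0 0)
    · simpa using (hσ x ⟨by linarith [hx.1], by linarith [hx.2]⟩).le
    · simpa using hσ π ⟨by linarith, by linarith⟩
  obtain ⟨b, hb, -, -, hfb⟩ := exists_zero_ne_of_orthogonal hf hper horth le_rfl le_rfl
    (by linarith : a < a + 2 * π) ha ha ha
  obtain ⟨c, hc, hcb, -, hfc⟩ := exists_zero_ne_of_orthogonal hf hper horth hb.1.le le_rfl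
    hb.2 ha hfb hfb
  obtain ⟨d, hd, hdb, hdc, hfd⟩ :
      ∃ d ∈ Set.Ioo a (a + 2 * π), d ≠ b ∧ d ≠ c ∧ f d = 0 := by
    rcases le_total b c with h | h
    · exact exists_zero_ne_of_orthogonal hf hper horth hb.1.le h hc.2 ha hfb hfc
    · obtain ⟨d, hd, h₁, h₂, h₃⟩ :=
        exists_zero_ne_of_orthogonal hf hper horth hc.1.le h hb.2 ha hfc hfb
      exact ⟨d, hd, h₂, h₁, h₃⟩
  refine ⟨a, ![a, b, c, d], ?_, ?_, ?_⟩
  · have := hb.1.ne; have := hc.1.ne; have := hd.1.ne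
    intro i j hij
    fin_cases i <;> fin_cases j <;> simp_all
  · intro i
    fin_cases i
    · exact ⟨le_rfl, by simpa using hπ⟩
    · exact ⟨hb.1.le, hb.2⟩
    · exact ⟨hc.1.le, hc.2⟩
    · exact ⟨hd.1.le, hd.2⟩
  · intro i
    fin_cases i <;> assumption

end FourZeros

section Support

/-- If `h = X sin - Y cos` has derivative `X cos + Y sin`, the normal component of the chord
from `(X, Y) (α - γ)` to `(X, Y) (α + γ)` is orthogonal to `1`, `cos` and `sin`. -/
lemma integral_chord_mul_trig_eq_zero {X Y : ℝ → ℝ} (hX : Continuous X) (hY : Continuous Y)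
    (hXp : Function.Periodic X (2 * π)) (hYp : Function.Periodic Y (2 * π))
    (hderiv : ∀ θ, HasDerivAt (fun θ => X θ * sin θ - Y θ * cos θ)
      (X θ * cos θ + Y θ * sin θ) θ) (γ a p q r : ℝ) :
    ∫ α in a..a + 2 * π, ((X (α + γ) - X (α - γ)) * sin α - (Y (α + γ) - Y (α - γ)) * cos α) *
      (p + q * cos α + r * sin α) = 0 := by
  set h : ℝ → ℝ := fun θ => X θ * sin θ - Y θ * cos θ with hh
  set g : ℝ → ℝ := fun θ => X θ * cos θ + Y θ * sin θ with hg
  set G : ℝ → ℝ := fun θ => p + q * cos θ + r * sin θ with hG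
  have hhc : Continuous h := by fun_prop
  have hgc : Continuous g := by fun_prop
  have hGc : Continuous G := by fun_prop
  have hhp : Function.Periodic h (2 * π) := fun x => by simp [hh, hXp x, hYp x]
  have hgp : Function.Periodic g (2 * π) := fun x => by simp [hg, hXp x, hYp x]
  have hGp : Function.Periodic G (2 * π) := fun x => by simp [hG]
  set K : ℝ → ℝ := fun θ => G (θ - γ) * (cos γ * h θ - sin γ * g θ) with hK
  set M : ℝ → ℝ := fun θ => G (θ + γ) * (cos γ * h θ + sin γ * g θ) with hM
  have hKc : Continuous K := by fun_prop
  have hMc : Continuous M := by fun_prop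
  have hKp : Function.Periodic K (2 * π) := fun x => by
    simp only [hK, hhp x, hgp x, show x + 2 * π - γ = x - γ + 2 * π by ring, hGp _]
  have hMp : Function.Periodic M (2 * π) := fun x => by
    simp only [hM, hhp x, hgp x, show x + 2 * π + γ = x + γ + 2 * π by ring, hGp _]
  have hsplit : ∀ α, ((X (α + γ) - X (α - γ)) * sin α - (Y (α + γ) - Y (α - γ)) * cos α) *
      (p + q * cos α + r * sin α) = K (α + γ) - M (α - γ) := by
    intro α
    have hc := sin_sq_add_cos_sq γ
    simp only [hK, hM, hh, hg, hG, add_sub_cancel_right, sub_add_cancel]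
    rw [sin_add, cos_add, sin_sub, cos_sub]
    linear_combination (-(((X (α + γ) - X (α - γ)) * sin α - (Y (α + γ) - Y (α - γ)) * cos α) *
      (p + q * cos α + r * sin α))) * hc
  have hW : ∀ θ, HasDerivAt (fun θ => -sin γ * (h θ * (G (θ - γ) + G (θ + γ))))
      (K θ - M θ) θ := by
    intro θ
    have hGd : ∀ x, HasDerivAt G (q * -sin x + r * cos x) x := fun x =>
      (((hasDerivAt_cos x).const_mul q).const_add p).add ((hasDerivAt_sin x).const_mul r)
    have h₁ := (hGd (θ - γ)).comp_sub_const θ γ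
    have h₂ := (hGd (θ + γ)).comp_add_const θ γ
    refine (((hderiv θ).mul (h₁.add h₂)).const_mul (-sin γ)).congr_deriv ?_
    simp only [hK, hM, hg, hG, sin_add, cos_add, sin_sub, cos_sub, Pi.add_apply]
    ring
  simp_rw [hsplit]
  rw [intervalIntegral.integral_sub ((by fun_prop : Continuous _).intervalIntegrable _ _)
    ((by fun_prop : Continuous _).intervalIntegrable _ _),
    intervalIntegral.integral_comp_add_right K, intervalIntegral.integral_comp_sub_right M,
    show a + 2 * π + γ = a + γ + 2 * π by ring, show a + 2 * π - γ = a - γ + 2 * π by ring,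
    hKp.intervalIntegral_add_eq (a + γ) a, hMp.intervalIntegral_add_eq (a - γ) a,
    ← intervalIntegral.integral_sub (hKc.intervalIntegrable _ _) (hMc.intervalIntegrable _ _),
    intervalIntegral.integral_eq_sub_of_hasDerivAt (fun θ _ => hW θ)
      ((hKc.sub hMc).intervalIntegrable _ _)]
  simp only [hhp a, show a + 2 * π - γ = a - γ + 2 * π by ring,
    show a + 2 * π + γ = a + γ + 2 * π by ring, hGp _, sub_self]

end Support

section Support

/-- The value at `y` of the linear functional with direction angle `θ - π / 2`. -/
noncomputable def supportForm (θ : ℝ) (y : Plane) : ℝ := y 0 * sin θ - y 1 * cos θ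

lemma continuous_supportForm : Continuous fun p : ℝ × Plane => supportForm p.1 p.2 := by
  unfold supportForm
  fun_prop

/-- The outward normal vector dual to `supportForm θ`. -/
noncomputable def outerNormal (θ : ℝ) : Plane := !₂[sin θ, -cos θ]

/-- The unit vector at angle `θ`. -/
noncomputable def unitVec (θ : ℝ) : Plane := !₂[cos θ, sin θ]

lemma continuous_unitVec : Continuous unitVec := by
  unfold unitVec
  fun_prop

lemma norm_unitVec (θ : ℝ) : ‖unitVec θ‖ = 1 := by
  simp [unitVec, EuclideanSpace.norm_eq, Fin.sum_univ_two]

lemma inner_unitVec (θ φ : ℝ) : inner ℝ (unitVec θ) (unitVec φ) = cos (θ - φ) := by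
  simp [unitVec, PiLp.inner_apply, Fin.sum_univ_two, cos_sub]
  ring

lemma not_mem_interior_of_maximizer {Ω : Set Plane} {θ : ℝ} {x : Plane}
    (hmax : ∀ y ∈ Ω, supportForm θ y ≤ supportForm θ x) : x ∉ interior Ω := by
  intro hx
  have hcont : Filter.Tendsto (fun ε : ℝ => x + ε • outerNormal θ) (nhdsWithin 0 (Set.Ioi 0))
      (nhds x) := by
    have : Continuous fun ε : ℝ => x + ε • outerNormal θ := by fun_prop
    simpa using (this.tendsto 0).mono_left nhdsWithin_le_nhds
  obtain ⟨ε, hε, hε₀⟩ := ((hcont.eventually (mem_interior_iff_mem_nhds.1 hx)).and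
    self_mem_nhdsWithin).exists
  have := hmax _ hε
  simp [supportForm, outerNormal] at this hε₀
  nlinarith [sin_sq_add_cos_sq θ]

lemma maximizer_unique {Ω : Set Plane} (hconv : StrictConvex ℝ Ω) {θ : ℝ} {x y : Plane}
    (hxΩ : x ∈ Ω) (hyΩ : y ∈ Ω) (hx : ∀ z ∈ Ω, supportForm θ z ≤ supportForm θ x)
    (hy : ∀ z ∈ Ω, supportForm θ z ≤ supportForm θ y) : x = y := by
  by_contra hne
  have hmid := hconv hxΩ hyΩ hne (a := 1 / 2) (b := 1 / 2) (by norm_num) (by norm_num)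
    (by norm_num)
  refine not_mem_interior_of_maximizer (θ := θ) (fun z hz => ?_) hmid
  have h₁ := hx z hz
  have h₂ := hy z hz
  simp [supportForm] at h₁ h₂ ⊢
  linarith

lemma continuous_maximizer {Ω : Set Plane} (hcomp : IsCompact Ω) (hconv : StrictConvex ℝ Ω)
    {x : ℝ → Plane} (hxΩ : ∀ θ, x θ ∈ Ω)
    (hx : ∀ θ, ∀ z ∈ Ω, supportForm θ z ≤ supportForm θ (x θ)) : Continuous x := by
  rw [continuous_iff_continuousAt]
  intro θ
  refine hcomp.tendsto_nhds_of_unique_mapClusterPt (.of_forall hxΩ) fun y hy hcl => ?_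
  obtain ⟨U, hU, hUy⟩ := mapClusterPt_iff_ultrafilter.1 hcl
  refine maximizer_unique hconv hy (hxΩ θ) (fun z hz => ?_) (hx θ)
  have hleft : Filter.Tendsto (fun t => supportForm t z) U (nhds (supportForm θ z)) :=
    ((continuous_supportForm.comp (by fun_prop : Continuous fun t : ℝ => (t, z))).tendsto
      θ).mono_left hU
  have hright : Filter.Tendsto (fun t => supportForm t (x t)) U (nhds (supportForm θ y)) :=
    (continuous_supportForm.tendsto (θ, y)).comp
      ((Filter.tendsto_id.mono_left hU).prodMk_nhds hUy)
  exact le_of_tendsto_of_tendsto' hleft hright fun t => hx t z hz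

lemma hasDerivAt_mul_sub_self {φ u : ℝ → ℝ} {u' θ : ℝ} (hφ : ContinuousAt φ θ)
    (hu : HasDerivAt u u' θ) : HasDerivAt (fun t => φ t * (u t - u θ)) (φ θ * u') θ := by
  rw [hasDerivAt_iff_tendsto_slope] at hu ⊢
  refine ((hφ.tendsto.mono_left nhdsWithin_le_nhds).mul hu).congr fun t => ?_
  simp [slope_def_field]
  ring

lemma hasDerivAt_of_squeeze {A B H : ℝ → ℝ} {θ d : ℝ} (hA : HasDerivAt A d θ)
    (hB : HasDerivAt B d θ) (hAθ : A θ = 0) (hBθ : B θ = 0)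
    (hAH : ∀ t, A t ≤ H t - H θ) (hHB : ∀ t, H t - H θ ≤ B t) : HasDerivAt H d θ := by
  rw [hasDerivAt_iff_isLittleO] at *
  refine (Asymptotics.IsBigO.of_norm_le fun t => ?_).trans_isLittleO
    (hA.norm_left.add hB.norm_left)
  have h₁ := hAH t
  have h₂ := hHB t
  simp only [hAθ, hBθ, sub_zero, Real.norm_eq_abs, smul_eq_mul]
  refine abs_le.2 ⟨?_, ?_⟩
  · linarith [neg_abs_le (A t - (t - θ) * d), abs_nonneg (B t - (t - θ) * d)]
  · linarith [le_abs_self (B t - (t - θ) * d), abs_nonneg (A t - (t - θ) * d)]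

/-- The envelope theorem for the support function. -/
lemma hasDerivAt_support {Ω : Set Plane} {x : ℝ → Plane} (hxc : Continuous x)
    (hxΩ : ∀ θ, x θ ∈ Ω)
    (hx : ∀ θ, ∀ z ∈ Ω, supportForm θ z ≤ supportForm θ (x θ)) (θ : ℝ) :
    HasDerivAt (fun θ => x θ 0 * sin θ - x θ 1 * cos θ) (x θ 0 * cos θ + x θ 1 * sin θ) θ := by
  have hA := ((hasDerivAt_mul_sub_self (continuousAt_const (y := x θ 0)) (hasDerivAt_sin θ)).sub
    (hasDerivAt_mul_sub_self (continuousAt_const (y := x θ 1)) (hasDerivAt_cos θ)))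
  have hB := ((hasDerivAt_mul_sub_self (φ := fun t => x t 0)
      (Continuous.continuousAt (by fun_prop)) (hasDerivAt_sin θ)).sub
    (hasDerivAt_mul_sub_self (φ := fun t => x t 1)
      (Continuous.continuousAt (by fun_prop)) (hasDerivAt_cos θ)))
  simp only [mul_neg, sub_neg_eq_add] at hA hB
  refine hasDerivAt_of_squeeze hA hB (by simp) (by simp) (fun t => ?_) (fun t => ?_)
  · have := hx t _ (hxΩ θ)
    simp only [supportForm, Pi.sub_apply] at this ⊢
    linarith
  · have := hx θ _ (hxΩ t)
    simp only [supportForm, Pi.sub_apply] at this ⊢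
    linarith

end Support

section Curve

namespace IsArclengthParam

variable {Ω : Set Plane} {c : ℝ → Plane} {L : ℝ}

lemma deriv_eq_of_eq (hparam : IsArclengthParam Ω c L) {u v : ℝ} (huv : c u = c v) :
    deriv c u = deriv c v := by
  have hper : Function.Periodic (fun t => (c t, deriv c t)) L := fun t => by
    have hshift : (fun y => c (y + L)) = c := funext hparam.periodic
    have hd : deriv c (t + L) = deriv c t := by
      rw [← deriv_comp_add_const, hshift]
    simp only [hparam.periodic t, hd]
  obtain ⟨u', hu', hu⟩ := hper.exists_mem_Ico₀ hparam.hL u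
  obtain ⟨v', hv', hv⟩ := hper.exists_mem_Ico₀ hparam.hL v
  simp only [Prod.mk.injEq] at hu hv
  rw [hu.2, hv.2, hparam.injOn hu' hv' (by rw [← hu.1, ← hv.1, huv])]

/-- The tangent vector depends continuously on the boundary point. -/
lemma continuous_deriv_comp (hparam : IsArclengthParam Ω c L) {s : ℝ → ℝ}
    (hs : ∀ θ, s θ ∈ Set.Icc 0 L) (hcs : Continuous fun θ => c (s θ)) :
    Continuous fun θ => deriv c (s θ) := by
  have hd : Continuous (deriv c) := hparam.contDiff.continuous_deriv le_rfl
  rw [continuous_iff_continuousAt]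
  intro θ
  refine Filter.tendsto_iff_ultrafilter _ _ _ |>.2 fun U hU => ?_
  obtain ⟨t, -, ht⟩ := isCompact_Icc.ultrafilter_le_nhds (U.map s)
    (Filter.le_principal_iff.2 (Filter.mem_map.2 (Filter.univ_mem' hs)))
  have ht' : Filter.Tendsto s U (nhds t) := ht
  have hct : c t = c (s θ) := tendsto_nhds_unique
    ((hparam.contDiff.continuous.tendsto t).comp ht') ((hcs.tendsto θ).mono_left hU)
  have hlim : Filter.Tendsto (fun θ => deriv c (s θ)) U (nhds (deriv c t)) :=
    (hd.tendsto t).comp ht'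
  rwa [hparam.deriv_eq_of_eq hct] at hlim

lemma supportForm_deriv_eq_zero (hparam : IsArclengthParam Ω c L) {θ u : ℝ}
    (hmax : ∀ t, supportForm θ (c t) ≤ supportForm θ (c u)) :
    supportForm θ (deriv c u) = 0 := by
  have hc : HasDerivAt c (deriv c u) u :=
    (hparam.contDiff.differentiable one_ne_zero u).hasDerivAt
  have hi : ∀ i : Fin 2, HasDerivAt (fun t => c t i) (deriv c u i) u := fun i =>
    (EuclideanSpace.proj (𝕜 := ℝ) i).hasFDerivAt.comp_hasDerivAt u hc
  exact IsLocalMax.hasDerivAt_eq_zero (f := fun t => supportForm θ (c t)) (.of_forall hmax)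
    (((hi 0).mul_const _).sub ((hi 1).mul_const _))

end IsArclengthParam

/-- A vector annihilated by `supportForm θ` is a multiple of `unitVec θ`. -/
lemma eq_inner_smul_unitVec {θ : ℝ} {v : Plane} (hv : supportForm θ v = 0) :
    v = inner ℝ v (unitVec θ) • unitVec θ := by
  have h := sin_sq_add_cos_sq θ
  simp only [supportForm] at hv
  ext i
  fin_cases i
  · simp [unitVec, PiLp.inner_apply, Fin.sum_univ_two]
    linear_combination (-v 0) * h + sin θ * hv
  · simp [unitVec, PiLp.inner_apply, Fin.sum_univ_two]
    linear_combination (-v 1) * h - cos θ * hv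

/-- The boundary of a strictly convex body is parametrized continuously by the tangent angle,
with a globally constant orientation `σ`. -/
lemma exists_tangent_angle_parametrization {Ω : Set Plane} {c : ℝ → Plane} {L : ℝ}
    (hcomp : IsCompact Ω) (hconv : StrictConvex ℝ Ω) (hparam : IsArclengthParam Ω c L) :
    ∃ (s : ℝ → ℝ) (σ : ℝ), (σ = 1 ∨ σ = -1) ∧ (Continuous fun θ => c (s θ)) ∧
      (Function.Periodic (fun θ => c (s θ)) (2 * π)) ∧ (∀ θ, c (s θ) ∈ Ω) ∧
      (∀ θ, ∀ z ∈ Ω, supportForm θ z ≤ supportForm θ (c (s θ))) ∧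
      ∀ θ, deriv c (s θ) = σ • unitVec θ := by
  have hcΩ : ∀ t, c t ∈ Ω := fun t =>
    hcomp.isClosed.frontier_subset (hparam.range_eq ▸ Set.mem_range_self t)
  have hex : ∀ θ, ∃ u ∈ Set.Icc 0 L, ∀ z ∈ Ω, supportForm θ z ≤ supportForm θ (c u) := by
    intro θ
    obtain ⟨x, hxΩ, hx⟩ := hcomp.exists_isMaxOn ⟨c 0, hcΩ 0⟩
      (f := supportForm θ)
      (continuous_supportForm.comp (by fun_prop : Continuous fun y : Plane => (θ, y))).continuousOn
    have hxf : x ∈ Set.range c := by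
      rw [hparam.range_eq]
      exact ⟨subset_closure hxΩ, not_mem_interior_of_maximizer hx⟩
    obtain ⟨u, rfl⟩ := hxf
    obtain ⟨v, hv, huv⟩ := hparam.periodic.exists_mem_Ico₀ hparam.hL u
    exact ⟨v, Set.Ico_subset_Icc_self hv, huv ▸ hx⟩
  choose s hs hmax using hex
  have hcont : Continuous fun θ => c (s θ) :=
    continuous_maximizer hcomp hconv (fun θ => hcΩ (s θ)) hmax
  have hper : Function.Periodic (fun θ => c (s θ)) (2 * π) := fun θ =>
    maximizer_unique hconv (hcΩ _) (hcΩ _) (θ := θ)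
      (by simpa [supportForm] using hmax (θ + 2 * π)) (hmax θ)
  have hpar : ∀ θ, deriv c (s θ) = inner ℝ (deriv c (s θ)) (unitVec θ) • unitVec θ := fun θ =>
    eq_inner_smul_unitVec (hparam.supportForm_deriv_eq_zero fun t => hmax θ _ (hcΩ t))
  set ε : ℝ → ℝ := fun θ => inner ℝ (deriv c (s θ)) (unitVec θ) with hε
  have hεc : Continuous ε := (hparam.continuous_deriv_comp hs hcont).inner continuous_unitVec
  have hε₁ : ∀ θ, |ε θ| = 1 := fun θ => by
    have h := hparam.unitSpeed (s θ)
    rwa [hpar θ, norm_smul, norm_unitVec, mul_one, Real.norm_eq_abs] at h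
  have hε₀ : ∀ θ, ε θ ≠ 0 := fun θ h => by simpa [h] using hε₁ θ
  refine ⟨s, ε 0, eq_or_eq_neg_of_abs_eq (hε₁ 0), hcont, hper, fun θ => hcΩ _, hmax,
    fun θ => ?_⟩
  suffices hθ : ε θ = ε 0 by rw [← hθ]; exact hpar θ
  by_contra hne
  have h0 : (0 : ℝ) ∈ Set.range ε := by
    rcases eq_or_eq_neg_of_abs_eq (hε₁ θ) with h | h <;>
      rcases eq_or_eq_neg_of_abs_eq (hε₁ 0) with h' | h'
    · exact absurd (h.trans h'.symm) hne
    · exact mem_range_of_exists_le_of_exists_ge hεc ⟨0, by linarith⟩ ⟨θ, by linarith⟩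
    · exact mem_range_of_exists_le_of_exists_ge hεc ⟨θ, by linarith⟩ ⟨0, by linarith⟩
    · exact absurd (h.trans h'.symm) hne
  obtain ⟨φ, hφ⟩ := h0
  exact hε₀ φ hφ

lemma angle_unitVec {α β γ : ℝ} (hγ0 : 0 ≤ γ) (hγ1 : γ ≤ π) (h : cos (α - β) = cos γ) :
    angle (unitVec α) (unitVec β) = γ := by
  rw [angle, inner_unitVec, norm_unitVec, norm_unitVec, h, mul_one, div_one,
    arccos_cos hγ0 hγ1]

lemma supportForm_smul_unitVec (θ α r : ℝ) :
    supportForm θ (r • unitVec α) = r * sin (θ - α) := by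
  simp [supportForm, unitVec, sin_sub]
  ring

/-- A nonzero chord between the support points at `α - γ` and `α + γ` whose normal component
at `α` vanishes is a positive multiple of `unitVec α`. -/
lemma exists_pos_smul_unitVec {Ω : Set Plane} {x y : Plane} {α γ : ℝ} (hγ : 0 < sin γ)
    (hmax : ∀ z ∈ Ω, supportForm (α - γ) z ≤ supportForm (α - γ) x) (hy : y ∈ Ω)
    (hne : y ≠ x) (hzero : supportForm α (y - x) = 0) :
    ∃ r : ℝ, 0 < r ∧ y - x = r • unitVec α := by
  obtain ⟨r, hr⟩ : ∃ r : ℝ, y - x = r • unitVec α := ⟨_, eq_inner_smul_unitVec hzero⟩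
  refine ⟨r, lt_of_le_of_ne ?_ ?_, hr⟩
  · have hle : supportForm (α - γ) (y - x) ≤ 0 := by
      have := hmax y hy
      simp only [supportForm, PiLp.sub_apply] at this ⊢
      linarith
    rw [hr, supportForm_smul_unitVec, show α - γ - α = -γ by ring, sin_neg] at hle
    by_contra! h
    nlinarith
  · rintro rfl
    exact hne (by simpa [sub_eq_zero] using hr)

lemma unitVec_injOn_Ico {a α β : ℝ} (hα : α ∈ Set.Ico a (a + 2 * π))
    (hβ : β ∈ Set.Ico a (a + 2 * π)) (h : unitVec α = unitVec β) : α = β := by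
  have hc : cos (α - β) = 1 := by
    rw [← inner_unitVec, h, inner_unitVec, sub_self, cos_zero]
  rw [cos_eq_one_iff_of_lt_of_lt (by linarith [hα.1, hβ.2]) (by linarith [hα.2, hβ.1])] at hc
  linarith

end Curve

/-- any compact strictly convex plane body floats in neutral
equilibrium at any contact angle in at least four distinct orientations:
there are at least four directed chords, with pairwise distinct directions,
making angle `γ` with the boundary at both endpoints. -/
theorem four_floating_orientations (Ω : Set Plane) (c : ℝ → Plane) (L : ℝ)
    (hcomp : IsCompact Ω) (hconv : StrictConvex ℝ Ω)
    (hint : (interior Ω).Nonempty) (hparam : IsArclengthParam Ω c L)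
    (γ : ℝ) (hγ0 : 0 < γ) (hγ1 : γ < π / 2) :
    ∃ s t : Fin 4 → ℝ,
      (∀ i, c (s i) ≠ c (t i) ∧
        angle (c (t i) - c (s i)) (deriv c (s i)) = γ ∧
        angle (c (t i) - c (s i)) (deriv c (t i)) = γ) ∧
      Function.Injective
        (fun i : Fin 4 => (‖c (t i) - c (s i)‖)⁻¹ • (c (t i) - c (s i))) := by

  obtain ⟨s, σ, hσ, hcont, hper, hΩ, hmax, hderiv⟩ :=
    exists_tangent_angle_parametrization hcomp hconv hparam
  have hsin : 0 < sin γ := sin_pos_of_pos_of_lt_pi hγ0 (by linarith)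
  have hne : ∀ α, c (s (α + γ)) ≠ c (s (α - γ)) := by
    intro α h
    have hd := hparam.deriv_eq_of_eq h
    rw [hderiv, hderiv, smul_right_inj (by rcases hσ with rfl | rfl <;> norm_num)] at hd
    have hcos := inner_unitVec (α + γ) (α - γ)
    rw [hd, inner_unitVec, sub_self, cos_zero, show α + γ - (α - γ) = 2 * γ by ring,
      cos_two_mul'] at hcos
    nlinarith [sin_sq_add_cos_sq γ]
  have hcoord : ∀ i : Fin 2, Continuous fun θ => c (s θ) i := fun i =>
    (EuclideanSpace.proj (𝕜 := ℝ) i).continuous.comp hcont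
  have horth := integral_chord_mul_trig_eq_zero
    (X := fun θ => c (s θ) 0) (Y := fun θ => c (s θ) 1) (hcoord 0) (hcoord 1)
    (fun θ => congrArg (fun v : Plane => v 0) (hper θ))
    (fun θ => congrArg (fun v : Plane => v 1) (hper θ))
    (hasDerivAt_support hcont hΩ hmax) γ
  have hcont' : ∀ (i : Fin 2) (δ : ℝ), Continuous fun α => c (s (α + δ)) i := fun i δ =>
    (hcoord i).comp (continuous_add_const δ)
  have hchordc : Continuous fun α => (c (s (α + γ)) 0 - c (s (α - γ)) 0) * sin α -
      (c (s (α + γ)) 1 - c (s (α - γ)) 1) * cos α :=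
    (((hcont' 0 γ).sub (hcont' 0 (-γ))).mul continuous_sin).sub
      (((hcont' 1 γ).sub (hcont' 1 (-γ))).mul continuous_cos)
  have hchordp : Function.Periodic (fun α => (c (s (α + γ)) 0 - c (s (α - γ)) 0) * sin α -
      (c (s (α + γ)) 1 - c (s (α - γ)) 1) * cos α) (2 * π) := fun α => by
    have h₁ : c (s (α + 2 * π + γ)) = c (s (α + γ)) := by
      rw [add_right_comm]; exact hper (α + γ)
    have h₂ : c (s (α + 2 * π - γ)) = c (s (α - γ)) := by
      rw [add_sub_right_comm]; exact hper (α - γ)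
    simp only [h₁, h₂, sin_add_two_pi, cos_add_two_pi]
  obtain ⟨a, z, hz, hza, hfz⟩ := exists_four_zeros_of_orthogonal hchordc hchordp horth
  choose r hr hchord using fun i => exists_pos_smul_unitVec hsin (hmax (z i - γ))
    (hΩ (z i + γ)) (hne (z i)) (by simpa [supportForm] using hfz i)
  have hangle₁ : ∀ i, angle (unitVec (z i)) (unitVec (z i - γ)) = γ := fun i =>
    angle_unitVec hγ0.le (by linarith) (by ring_nf)
  have hangle₂ : ∀ i, angle (unitVec (z i)) (unitVec (z i + γ)) = γ := fun i =>
    angle_unitVec hγ0.le (by linarith) (by rw [← cos_neg]; ring_nf)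
  have hdir : ∀ i, ‖r i • unitVec (z i)‖⁻¹ • r i • unitVec (z i) = unitVec (z i) := fun i => by
    rw [norm_smul, norm_unitVec, mul_one, Real.norm_of_nonneg (hr i).le,
      inv_smul_smul₀ (hr i).ne']
  rcases hσ with rfl | rfl
  · refine ⟨fun i => s (z i - γ), fun i => s (z i + γ),
      fun i => ⟨(hne (z i)).symm, ?_, ?_⟩, fun i j hij => ?_⟩
    · rw [hchord, hderiv, one_smul, angle_smul_left_of_pos _ _ (hr i), hangle₁]
    · rw [hchord, hderiv, one_smul, angle_smul_left_of_pos _ _ (hr i), hangle₂]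
    · simp only [hchord, hdir] at hij
      exact hz (unitVec_injOn_Ico (hza i) (hza j) hij)
  · have hrev : ∀ i, c (s (z i - γ)) - c (s (z i + γ)) = -(r i • unitVec (z i)) := fun i => by
      rw [← hchord, neg_sub]
    refine ⟨fun i => s (z i + γ), fun i => s (z i - γ),
      fun i => ⟨hne (z i), ?_, ?_⟩, fun i j hij => ?_⟩
    · rw [hrev, hderiv, neg_one_smul, angle_neg_neg, angle_smul_left_of_pos _ _ (hr i), hangle₂]
    · rw [hrev, hderiv, neg_one_smul, angle_neg_neg, angle_smul_left_of_pos _ _ (hr i), hangle₁]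
    · simp only [hrev, norm_neg, smul_neg, hdir, neg_inj] at hij
      exact hz (unitVec_injOn_Ico (hza i) (hza j) hij)
end

section
/- There exist a compact strictly convex body Ω ⊂ ℝ² with C¹ arclength boundary parametrization c of period L, and an angle γ ∈ (0, π/2), such that the set of unit directions u ∈ ℝ² for which some directed chord of Ω with direction u makes angle γ with the boundary at both endpoints has exactly four elements. -/
open Real InnerProductGeometry

/-- A primitive of a continuous periodic function bounded below by a positive constant has
a strictly increasing inverse, which solves `φ' = 1 / v(φ)`. -/
theorem exists_arclength_reparam {v : ℝ → ℝ} {T m : ℝ} (hv : Continuous v) (hm : 0 < m)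
    (hmv : ∀ a, m ≤ v a) (hT : 0 < T) (hper : Function.Periodic v T) :
    ∃ (φ : ℝ → ℝ) (L : ℝ), 0 < L ∧ φ 0 = 0 ∧ StrictMono φ ∧ Function.Surjective φ ∧
      (∀ s, φ (s + L) = φ s + T) ∧ ∀ s, HasDerivAt φ (v (φ s))⁻¹ s := by
  set S : ℝ → ℝ := fun a => ∫ x in (0 : ℝ)..a, v x with hSdef
  have hS : ∀ a, HasDerivAt S (v a) a := fun a =>
    intervalIntegral.integral_hasDerivAt_right (hv.intervalIntegrable _ _)
      hv.stronglyMeasurable.stronglyMeasurableAtFilter hv.continuousAt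
  have hS0 : S 0 = 0 := intervalIntegral.integral_same
  have hmono : StrictMono S := strictMono_of_deriv_pos fun a => by
    rw [(hS a).deriv]; exact hm.trans_le (hmv a)
  have hcont : Continuous S := continuous_iff_continuousAt.2 fun a => (hS a).continuousAt
  have hadd : ∀ a, S (a + T) = S a + S T := fun a => by
    have h := hper.intervalIntegral_add_eq a 0
    have h' := intervalIntegral.integral_add_adjacent_intervals
      (hv.intervalIntegrable (μ := MeasureTheory.volume) 0 a) (hv.intervalIntegrable a (a + T))
    rw [h, zero_add] at h'
    exact h'.symm
  have hdiff : Monotone fun a => S a - m * a :=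
    monotone_of_deriv_nonneg
      (fun a => ((hS a).sub ((hasDerivAt_id a).const_mul m)).differentiableAt) fun a => by
        rw [show (fun a => S a - m * a) = S - fun a => m * id a from rfl,
          ((hS a).sub ((hasDerivAt_id a).const_mul m)).deriv]
        linarith [hmv a]
  have hsurj : Function.Surjective S := by
    refine hcont.surjective ?_ ?_
    · refine Filter.tendsto_atTop_mono' _ ?_ (Filter.tendsto_id.const_mul_atTop hm)
      filter_upwards [Filter.eventually_ge_atTop 0] with a ha
      have := hdiff ha
      simp only [hS0, mul_zero, sub_zero] at this
      simpa using this
    · refine Filter.tendsto_atBot_mono' _ ?_ (Filter.tendsto_id.const_mul_atBot hm)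
      filter_upwards [Filter.eventually_le_atBot 0] with a ha
      have := hdiff ha
      simp only [hS0, mul_zero, sub_zero] at this
      simpa using this
  set e : ℝ ≃o ℝ := hmono.orderIsoOfSurjective S hsurj with he
  have heS : ∀ a, e a = S a := fun _ => rfl
  refine ⟨e.symm, S T, ?_, ?_, e.symm.strictMono, e.symm.surjective, fun s => ?_, fun s => ?_⟩
  · rw [← hS0]; exact hmono hT
  · rw [OrderIso.symm_apply_eq, heS, hS0]
  · rw [OrderIso.symm_apply_eq, heS, hadd, ← heS (e.symm s), OrderIso.apply_symm_apply]
  · exact (hS (e.symm s)).of_local_left_inverse e.symm.continuous.continuousAt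
      (hm.trans_le (hmv _)).ne' (Filter.Eventually.of_forall e.apply_symm_apply)

/-- The linear automorphism `(x, y) ↦ (4x, 3y)` of the plane. -/
noncomputable def ellipseEquiv : Plane ≃L[ℝ] Plane :=
  LinearEquiv.toContinuousLinearEquiv
    { toFun := fun p => !₂[4 * p 0, 3 * p 1]
      invFun := fun p => !₂[p 0 / 4, p 1 / 3]
      map_add' := fun p q => by ext i; fin_cases i <;> simp <;> ring
      map_smul' := fun r p => by ext i; fin_cases i <;> simp <;> ring
      left_inv := fun p => by ext i; fin_cases i <;> simp
      right_inv := fun p => by ext i; fin_cases i <;> simp <;> ring }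

theorem ellipseEquiv_apply (p : Plane) : ellipseEquiv p = !₂[4 * p 0, 3 * p 1] := rfl

/-- The ellipse with semiaxes `4` and `3`. -/
noncomputable def ellipse : Set Plane := ellipseEquiv '' Metric.closedBall 0 1

theorem isCompact_ellipse : IsCompact ellipse :=
  (isCompact_closedBall 0 1).image ellipseEquiv.continuous

theorem strictConvex_ellipse : StrictConvex ℝ ellipse :=
  (strictConvex_closedBall ℝ (0 : Plane) 1).linear_image ellipseEquiv.toLinearEquiv.toLinearMap
    ellipseEquiv.toHomeomorph.isOpenMap

theorem interior_ellipse_nonempty : (interior ellipse).Nonempty := by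
  have h : interior ellipse = ellipseEquiv '' interior (Metric.closedBall 0 1) :=
    (ellipseEquiv.toHomeomorph.image_interior _).symm
  rw [h, interior_closedBall _ one_ne_zero]
  exact (Metric.nonempty_ball.2 one_pos).image _

theorem mem_frontier_ellipse {q : Plane} :
    q ∈ frontier ellipse ↔ ∃ θ : ℝ, !₂[4 * cos θ, 3 * sin θ] = q := by
  have h : frontier ellipse = ellipseEquiv '' frontier (Metric.closedBall 0 1) :=
    (ellipseEquiv.toHomeomorph.image_frontier _).symm
  rw [h, frontier_closedBall _ one_ne_zero]
  constructor
  · rintro ⟨p, hp, rfl⟩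
    have hp' : p 0 ^ 2 + p 1 ^ 2 = 1 := by
      have := EuclideanSpace.norm_sq_eq p
      rw [mem_sphere_zero_iff_norm.1 hp] at this
      simpa using this.symm
    have hz : ‖(⟨p 0, p 1⟩ : ℂ)‖ = 1 := by
      rw [Complex.norm_def, Complex.normSq_mk, ← sq, ← sq, hp', sqrt_one]
    refine ⟨Complex.arg ⟨p 0, p 1⟩, ?_⟩
    have hc := Complex.norm_mul_cos_arg ⟨p 0, p 1⟩
    have hs := Complex.norm_mul_sin_arg ⟨p 0, p 1⟩
    rw [hz, one_mul] at hc hs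
    rw [hc, hs, ellipseEquiv_apply]
  · rintro ⟨θ, rfl⟩
    refine ⟨!₂[cos θ, sin θ], ?_, by simp [ellipseEquiv_apply]⟩
    simp [EuclideanSpace.norm_eq]

/-- The speed of the parametrization `θ ↦ (4 cos θ, 3 sin θ)`. -/
noncomputable def ellipseSpeed (θ : ℝ) : ℝ := √((4 * sin θ) ^ 2 + (3 * cos θ) ^ 2)

theorem continuous_ellipseSpeed : Continuous ellipseSpeed := by
  unfold ellipseSpeed; fun_prop

theorem three_le_ellipseSpeed (θ : ℝ) : 3 ≤ ellipseSpeed θ :=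
  Real.le_sqrt_of_sq_le (by nlinarith [sin_sq_add_cos_sq θ, sq_nonneg (sin θ)])

theorem ellipseSpeed_pos (θ : ℝ) : 0 < ellipseSpeed θ :=
  three_pos.trans_le (three_le_ellipseSpeed θ)

theorem periodic_ellipseSpeed : Function.Periodic ellipseSpeed (2 * π) := fun θ => by
  simp [ellipseSpeed]

theorem ellipseSpeed_sq (θ : ℝ) :
    ellipseSpeed θ ^ 2 = (4 * sin θ) ^ 2 + (3 * cos θ) ^ 2 :=
  Real.sq_sqrt (by positivity)

theorem norm_ellipse_tangent (θ : ℝ) :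
    ‖(!₂[-(4 * sin θ), 3 * cos θ] : Plane)‖ = ellipseSpeed θ := by
  simp [EuclideanSpace.norm_eq, ellipseSpeed]

theorem norm_ellipse_unit_tangent (θ : ℝ) :
    ‖(ellipseSpeed θ)⁻¹ • (!₂[-(4 * sin θ), 3 * cos θ] : Plane)‖ = 1 := by
  rw [norm_smul, norm_ellipse_tangent, norm_inv, norm_of_nonneg (ellipseSpeed_pos θ).le,
    inv_mul_cancel₀ (ellipseSpeed_pos θ).ne']

theorem hasDerivAt_ellipse (θ : ℝ) :
    HasDerivAt (fun θ => (!₂[4 * cos θ, 3 * sin θ] : Plane)) !₂[-(4 * sin θ), 3 * cos θ] θ := by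
  have h : HasDerivAt (fun θ => ![4 * cos θ, 3 * sin θ]) ![-(4 * sin θ), 3 * cos θ] θ := by
    rw [hasDerivAt_pi]
    intro i
    fin_cases i
    · simpa using (hasDerivAt_cos θ).const_mul 4
    · simpa using (hasDerivAt_sin θ).const_mul 3
  exact (PiLp.hasFDerivAt_toLp (𝕜 := ℝ) 2 _).comp_hasDerivAt θ h

/-- The ellipse has an arclength parametrization of the form `c s = (4 cos φ(s), 3 sin φ(s))`
with `φ` a bijection and the expected unit tangent. -/
theorem exists_ellipse_arclengthParam :
    ∃ (c : ℝ → Plane) (L : ℝ) (φ : ℝ → ℝ), IsArclengthParam ellipse c L ∧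
      Function.Surjective φ ∧ (∀ s, c s = !₂[4 * cos (φ s), 3 * sin (φ s)]) ∧
      ∀ s, deriv c s = (ellipseSpeed (φ s))⁻¹ • !₂[-(4 * sin (φ s)), 3 * cos (φ s)] := by
  obtain ⟨φ, L, hL, h0, hmono, hsurj, hper, hφ⟩ := exists_arclength_reparam
    continuous_ellipseSpeed three_pos three_le_ellipseSpeed two_pi_pos periodic_ellipseSpeed
  have hφc : Continuous φ := continuous_iff_continuousAt.2 fun s => (hφ s).continuousAt
  set c : ℝ → Plane := fun s => !₂[4 * cos (φ s), 3 * sin (φ s)] with hc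
  have hderiv : ∀ s, HasDerivAt c
      ((ellipseSpeed (φ s))⁻¹ • !₂[-(4 * sin (φ s)), 3 * cos (φ s)]) s := fun s =>
    (hasDerivAt_ellipse (φ s)).scomp s (hφ s)
  refine ⟨c, L, φ, ⟨hL, ?_, fun s => ?_, fun s => ?_, ?_, ?_⟩, hsurj, fun _ => rfl,
    fun s => (hderiv s).deriv⟩
  · rw [contDiff_one_iff_deriv]
    refine ⟨fun s => (hderiv s).differentiableAt, ?_⟩
    rw [funext fun s => (hderiv s).deriv]
    refine ((continuous_ellipseSpeed.comp hφc).inv₀ fun s => (ellipseSpeed_pos _).ne').smul ?_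
    fun_prop
  · rw [(hderiv s).deriv, norm_ellipse_unit_tangent]
  · simp [hc, hper]
  · intro s hs t ht hst
    have hcos : cos (φ s) = cos (φ t) := by simpa [hc] using congrArg (· 0) hst
    have hsin : sin (φ s) = sin (φ t) := by simpa [hc] using congrArg (· 1) hst
    obtain ⟨k, hk⟩ := Real.Angle.angle_eq_iff_two_pi_dvd_sub.1 (Real.Angle.cos_sin_inj hcos hsin)
    have hL' : φ L = 2 * π := by simpa [h0] using hper 0
    have hs0 := hmono.monotone hs.1
    have ht0 := hmono.monotone ht.1
    have hs1 := hmono hs.2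
    have ht1 := hmono ht.2
    rw [h0] at hs0 ht0
    rw [hL'] at hs1 ht1
    have hk1 : (k : ℝ) < 1 := by nlinarith [pi_pos]
    have hk2 : (-1 : ℝ) < k := by nlinarith [pi_pos]
    have hk0 : k = 0 := by
      have h1 : k < 1 := by exact_mod_cast hk1
      have h2 : -1 < k := by exact_mod_cast hk2
      omega
    refine hmono.injective ?_
    rw [hk0] at hk
    simpa [sub_eq_zero] using hk
  · ext q
    rw [mem_frontier_ellipse, Set.mem_range]
    exact (hsurj.exists (p := fun θ => (!₂[4 * cos θ, 3 * sin θ] : Plane) = q)).symm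

/-- If two vectors of lengths `α`, `β` have, relative to a vector of squared length `N`, inner
products `P`, `Q` with `P / α = Q / β` and cross products `±X ≠ 0`, then `P = Q`. -/
theorem eq_of_cos_eq_of_cross_sq_eq {P Q X α β N : ℝ} (hα : 0 < α) (hβ : 0 < β) (hX : X ≠ 0)
    (h : α⁻¹ * P = β⁻¹ * Q) (hP : N * α ^ 2 = P ^ 2 + X ^ 2) (hQ : N * β ^ 2 = Q ^ 2 + X ^ 2) :
    P = Q := by
  have h' : P * β = Q * α := by field_simp at h; linarith
  have hX2 : 0 < X ^ 2 := by positivity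
  have hN : 0 < N := by
    by_contra! hN
    nlinarith [sq_nonneg P, mul_nonneg (neg_nonneg.2 hN) (sq_nonneg α)]
  have hPQ : P ^ 2 = Q ^ 2 := by
    have h2 : P ^ 2 * (N * β ^ 2) = Q ^ 2 * (N * α ^ 2) := by
      linear_combination N * (P * β + Q * α) * h'
    rw [hP, hQ] at h2
    exact mul_right_cancel₀ hX2.ne' (by linear_combination h2)
  have hαβ : α = β := by
    have : α ^ 2 = β ^ 2 := mul_left_cancel₀ hN.ne' (by rw [hP, hQ, hPQ])
    exact (pow_left_inj₀ hα.le hβ.le two_ne_zero).1 this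
  subst hαβ
  exact mul_right_cancel₀ hα.ne' h'

/-- A chord of the ellipse making the same angle with the unit tangents at its two endpoints is
parallel to one of the axes. -/
theorem ellipse_chord_axis_parallel {a b : ℝ}
    (hne : (!₂[4 * cos b, 3 * sin b] : Plane) ≠ !₂[4 * cos a, 3 * sin a])
    (h : angle ((!₂[4 * cos b, 3 * sin b] : Plane) - !₂[4 * cos a, 3 * sin a])
        ((ellipseSpeed a)⁻¹ • !₂[-(4 * sin a), 3 * cos a]) =
      angle ((!₂[4 * cos b, 3 * sin b] : Plane) - !₂[4 * cos a, 3 * sin a])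
        ((ellipseSpeed b)⁻¹ • !₂[-(4 * sin b), 3 * cos b])) :
    cos b = cos a ∨ sin b = sin a := by
  have hinner := congrArg cos h
  rw [cos_angle, cos_angle, norm_ellipse_unit_tangent, norm_ellipse_unit_tangent, mul_one,
    div_left_inj' (norm_ne_zero_iff.2 (sub_ne_zero.2 hne)), inner_smul_right,
    inner_smul_right] at hinner
  simp only [PiLp.inner_apply, Fin.sum_univ_two, PiLp.sub_apply, RCLike.inner_apply,
    conj_trivial, Matrix.cons_val_zero, Matrix.cons_val_one] at hinner
  have ha := sin_sq_add_cos_sq a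
  have hb := sin_sq_add_cos_sq b
  have hX : 12 * (cos a * cos b + sin a * sin b - 1) ≠ 0 := by
    intro h0
    have h1 : (cos b - cos a) ^ 2 + (sin b - sin a) ^ 2 = 0 := by nlinarith
    have h2 : cos b - cos a = 0 := by
      nlinarith [sq_nonneg (cos b - cos a), sq_nonneg (sin b - sin a)]
    have h3 : sin b - sin a = 0 := by
      nlinarith [sq_nonneg (cos b - cos a), sq_nonneg (sin b - sin a)]
    exact hne (by rw [sub_eq_zero.1 h2, sub_eq_zero.1 h3])
  have hPQ := eq_of_cos_eq_of_cross_sq_eq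
    (N := (4 * (cos b - cos a)) ^ 2 + (3 * (sin b - sin a)) ^ 2)
    (ellipseSpeed_pos a) (ellipseSpeed_pos b) hX hinner
    (by
      rw [ellipseSpeed_sq,
        show 12 * (cos a * cos b + sin a * sin b - 1) =
          12 * (cos a * (cos b - cos a) + sin a * (sin b - sin a)) by linear_combination 12 * ha]
      ring)
    (by
      rw [ellipseSpeed_sq,
        show 12 * (cos a * cos b + sin a * sin b - 1) =
          -(12 * (cos b * (cos b - cos a) + sin b * (sin b - sin a))) by
            linear_combination 12 * hb]
      ring)
  have h0 : (cos b - cos a) * (sin b - sin a) = 0 := by linear_combination hPQ / 7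
  rcases mul_eq_zero.1 h0 with h1 | h1
  · exact Or.inl (sub_eq_zero.1 h1)
  · exact Or.inr (sub_eq_zero.1 h1)

/-- Normalizing a nonzero vector on a coordinate axis gives plus or minus a basis vector. -/
theorem inv_norm_smul_mem_of_axis {p : Plane} (hp : p ≠ 0) (h : p 0 = 0 ∨ p 1 = 0) :
    ‖p‖⁻¹ • p ∈ ({!₂[1, 0], !₂[-1, 0], !₂[0, 1], !₂[0, -1]} : Set Plane) := by
  have key : ∀ x : ℝ, x ≠ 0 → |x|⁻¹ * x = 1 ∨ |x|⁻¹ * x = -1 := fun x hx => by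
    rcases lt_or_gt_of_ne hx with h | h
    · right; rw [abs_of_neg h]; field_simp
    · left; rw [abs_of_pos h]; field_simp
  simp only [Set.mem_insert_iff, Set.mem_singleton_iff]
  rcases h with h | h
  · have h1 : p 1 ≠ 0 := fun h1 => hp (by ext i; fin_cases i <;> simp [h, h1])
    have hn : ‖p‖ = |p 1| := by simp [EuclideanSpace.norm_eq, h, sqrt_sq_eq_abs]
    rw [hn]
    rcases key _ h1 with hk | hk
    · right; right; left; ext i; fin_cases i <;> simp [h, hk]
    · right; right; right; ext i; fin_cases i <;> simp [h, hk]
  · have h1 : p 0 ≠ 0 := fun h1 => hp (by ext i; fin_cases i <;> simp [h, h1])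
    have hn : ‖p‖ = |p 0| := by simp [EuclideanSpace.norm_eq, h, sqrt_sq_eq_abs]
    rw [hn]
    rcases key _ h1 with hk | hk
    · left; ext i; fin_cases i <;> simp [h, hk]
    · right; left; ext i; fin_cases i <;> simp [h, hk]

theorem angle_smul_unit_eq_pi_div_four {r : ℝ} (hr : 0 < r) {u w : Plane} (hu : ‖u‖ = 1)
    (hw : ‖w‖ = 1) (h : inner ℝ u w = √2 / 2) : angle (r • u) w = π / 4 := by
  rw [angle_smul_left_of_pos _ _ hr, angle, hu, hw, h, mul_one, div_one, ← cos_pi_div_four,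
    arccos_cos (by positivity) (by linarith [pi_pos])]

/-- The points `(±16/5, ±9/5)` lie on the ellipse; at them the tangent has slope `±1`. -/
theorem exists_ellipse_diagonal_tangent {x y : ℝ} (hx : x ^ 2 = 1) (hy : y ^ 2 = 1) :
    ∃ θ : ℝ, (!₂[4 * cos θ, 3 * sin θ] : Plane) = !₂[x * (16 / 5), y * (9 / 5)] ∧
      (ellipseSpeed θ)⁻¹ • (!₂[-(4 * sin θ), 3 * cos θ] : Plane) =
        !₂[-y * (√2 / 2), x * (√2 / 2)] := by
  have hz : ‖(⟨x * (4 / 5), y * (3 / 5)⟩ : ℂ)‖ = 1 := by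
    rw [Complex.norm_def, Complex.normSq_mk, sqrt_eq_one]
    linear_combination 16 / 25 * hx + 9 / 25 * hy
  have hc := Complex.norm_mul_cos_arg ⟨x * (4 / 5), y * (3 / 5)⟩
  have hs := Complex.norm_mul_sin_arg ⟨x * (4 / 5), y * (3 / 5)⟩
  rw [hz, one_mul] at hc hs
  have hv : ellipseSpeed (Complex.arg ⟨x * (4 / 5), y * (3 / 5)⟩) = 12 / 5 * √2 := by
    rw [ellipseSpeed, hc, hs, sqrt_eq_iff_mul_self_eq (by positivity) (by positivity)]
    linear_combination 144 / 25 * (hx + hy - mul_self_sqrt (zero_le_two (α := ℝ)))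
  have h2 : √2 * √2 = 2 := mul_self_sqrt zero_le_two
  have hinv : (12 / 5 * √2)⁻¹ * (12 / 5) = √2 / 2 := by
    field_simp; linear_combination -h2
  refine ⟨Complex.arg ⟨x * (4 / 5), y * (3 / 5)⟩, ?_, ?_⟩
  · rw [hc, hs]
    ext i; fin_cases i <;> simp <;> ring
  · rw [hv, hc, hs]
    ext i
    fin_cases i
    · simp only [Fin.zero_eta, PiLp.smul_apply, Matrix.cons_val_zero, smul_eq_mul]
      linear_combination -y * hinv
    · simp only [Fin.mk_one, PiLp.smul_apply, Matrix.cons_val_one, Matrix.cons_val_zero, smul_eq_mul]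
      linear_combination x * hinv

theorem ncard_axis_directions :
    ({!₂[1, 0], !₂[-1, 0], !₂[0, 1], !₂[0, -1]} : Set Plane).ncard = 4 := by
  have hne : ∀ {p q : Plane}, p ≠ q ↔ ¬(p 0 = q 0 ∧ p 1 = q 1) := fun {p q} => by
    rw [not_iff_not]
    exact ⟨fun h => h ▸ ⟨rfl, rfl⟩, fun h => by ext i; fin_cases i; exacts [h.1, h.2]⟩
  rw [Set.ncard_insert_of_notMem, Set.ncard_insert_of_notMem, Set.ncard_pair]
  · rw [hne]; norm_num
  · simp only [Set.mem_insert_iff, Set.mem_singleton_iff, not_or]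
    refine ⟨hne.2 ?_, hne.2 ?_⟩ <;> norm_num
  · simp only [Set.mem_insert_iff, Set.mem_singleton_iff, not_or]
    refine ⟨hne.2 ?_, hne.2 ?_, hne.2 ?_⟩ <;> norm_num

/-- the lower bound of four orientations in the neutral-equilibrium
floating theorem is best possible: there is a compact strictly convex plane body
and a contact angle for which the set of directions of chords making angle `γ`
with the boundary at both endpoints has exactly four elements. -/
theorem four_orientations_optimal :
    ∃ (Ω : Set Plane) (c : ℝ → Plane) (L γ : ℝ),
      IsCompact Ω ∧ StrictConvex ℝ Ω ∧ (interior Ω).Nonempty ∧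
      IsArclengthParam Ω c L ∧ 0 < γ ∧ γ < π / 2 ∧
      {u : Plane | ∃ s t : ℝ, c s ≠ c t ∧
          angle (c t - c s) (deriv c s) = γ ∧
          angle (c t - c s) (deriv c t) = γ ∧
          u = (‖c t - c s‖)⁻¹ • (c t - c s)}.ncard = 4 := by
  obtain ⟨c, L, φ, hparam, hsurj, hc, hderiv⟩ := exists_ellipse_arclengthParam
  refine ⟨ellipse, c, L, π / 4, isCompact_ellipse, strictConvex_ellipse,
    interior_ellipse_nonempty, hparam, by positivity, by linarith [pi_pos], ?_⟩
  rw [← ncard_axis_directions]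
  congr 1
  have hexists : ∀ x y : ℝ, x ^ 2 = 1 → y ^ 2 = 1 → ∃ s,
      c s = !₂[x * (16 / 5), y * (9 / 5)] ∧ deriv c s = !₂[-y * (√2 / 2), x * (√2 / 2)] := by
    intro x y hx hy
    obtain ⟨θ, h1, h2⟩ := exists_ellipse_diagonal_tangent hx hy
    obtain ⟨s, rfl⟩ := hsurj θ
    exact ⟨s, by rw [hc, h1], by rw [hderiv, h2]⟩
  have hchord : ∀ (s t r : ℝ) (u : Plane), 0 < r → ‖u‖ = 1 → c t - c s = r • u →
      inner ℝ u (deriv c s) = √2 / 2 → inner ℝ u (deriv c t) = √2 / 2 →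
      ∃ s t : ℝ, c s ≠ c t ∧ angle (c t - c s) (deriv c s) = π / 4 ∧
        angle (c t - c s) (deriv c t) = π / 4 ∧ u = (‖c t - c s‖)⁻¹ • (c t - c s) := by
    intro s t r u hr hu hst hs ht
    refine ⟨s, t, fun h => ?_, ?_, ?_, ?_⟩
    · rw [h, sub_self, eq_comm, smul_eq_zero] at hst
      rcases hst with h | rfl
      · exact hr.ne' h
      · simp at hu
    · rw [hst, angle_smul_unit_eq_pi_div_four hr hu (hparam.unitSpeed s) hs]
    · rw [hst, angle_smul_unit_eq_pi_div_four hr hu (hparam.unitSpeed t) ht]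
    · rw [hst, norm_smul, hu, mul_one, norm_of_nonneg hr.le, inv_smul_smul₀ hr.ne']
  obtain ⟨s₁, hs₁, hd₁⟩ := hexists 1 1 (by norm_num) (by norm_num)
  obtain ⟨s₂, hs₂, hd₂⟩ := hexists (-1) 1 (by norm_num) (by norm_num)
  obtain ⟨s₃, hs₃, hd₃⟩ := hexists (-1) (-1) (by norm_num) (by norm_num)
  obtain ⟨s₄, hs₄, hd₄⟩ := hexists 1 (-1) (by norm_num) (by norm_num)
  apply Set.Subset.antisymm
  · rintro u ⟨s, t, hne, h1, h2, rfl⟩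
    refine inv_norm_smul_mem_of_axis (sub_ne_zero.2 hne.symm) ?_
    have h := h1.trans h2.symm
    rw [hderiv, hderiv, hc, hc] at h
    rw [hc, hc] at hne
    rcases ellipse_chord_axis_parallel hne.symm h with h | h
    · left; simp [hc, h]
    · right; simp [hc, h]
  · have hnorm : ∀ x y : ℝ, x ^ 2 + y ^ 2 = 1 → ‖(!₂[x, y] : Plane)‖ = 1 := fun x y h => by
      simp [EuclideanSpace.norm_eq, h]
    rintro u (rfl | rfl | rfl | rfl)
    · refine hchord s₃ s₄ (32 / 5) _ (by norm_num) (hnorm _ _ (by norm_num)) ?_ ?_ ?_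
      · rw [hs₃, hs₄]; ext i; fin_cases i <;> norm_num
      · simp [hd₃, PiLp.inner_apply]
      · simp [hd₄, PiLp.inner_apply]
    · refine hchord s₁ s₂ (32 / 5) _ (by norm_num) (hnorm _ _ (by norm_num)) ?_ ?_ ?_
      · rw [hs₁, hs₂]; ext i; fin_cases i <;> norm_num
      · simp [hd₁, PiLp.inner_apply]
      · simp [hd₂, PiLp.inner_apply]
    · refine hchord s₄ s₁ (18 / 5) _ (by norm_num) (hnorm _ _ (by norm_num)) ?_ ?_ ?_
      · rw [hs₄, hs₁]; ext i; fin_cases i <;> norm_num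
      · simp [hd₄, PiLp.inner_apply]
      · simp [hd₁, PiLp.inner_apply]
    · refine hchord s₂ s₃ (18 / 5) _ (by norm_num) (hnorm _ _ (by norm_num)) ?_ ?_ ?_
      · rw [hs₂, hs₃]; ext i; fin_cases i <;> norm_num
      · simp [hd₂, PiLp.inner_apply]
      · simp [hd₃, PiLp.inner_apply]
end

section
/- Let n ≥ 3 be an integer and γ ∈ (0, π/2) with tan(nγ) = n·tan(γ). Then there exists a compact strictly convex body Ω ⊂ ℝ² whose boundary admits a C^∞ arclength parametrization c of some period L, such that the boundary of Ω is not a circle, and for all s, t with c(s) ≠ c(t): if ∠(c(t)−c(s), c'(s)) = γ then ∠(c(t)−c(s), c'(t)) = γ. -/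
open Real InnerProductGeometry

/-- The unit vector in direction `θ`. -/
noncomputable def unitTangent (θ : ℝ) : Plane := !₂[cos θ, sin θ]

/-- The component of `x` along the unit vector obtained by turning `unitTangent θ` clockwise by a
right angle. -/
noncomputable def normalHeight (x : Plane) (θ : ℝ) : ℝ := x 0 * sin θ - x 1 * cos θ

/-- The body with support function `h`, as a function of the direction of the tangent. -/
def supportBody (h : ℝ → ℝ) : Set Plane := {x | ∀ θ, normalHeight x θ ≤ h θ}

/-- The envelope of the support lines, for a support function `h` with derivative `p`. -/
noncomputable def supportCurve (h p : ℝ → ℝ) (θ : ℝ) : Plane :=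
  !₂[h θ * sin θ + p θ * cos θ, p θ * sin θ - h θ * cos θ]

/-- `h` is a periodic support function with derivative `p` and positive radius of curvature `ρ`. -/
structure IsSupportFunction (h p ρ : ℝ → ℝ) : Prop where
  hasDerivAt : ∀ θ, HasDerivAt h (p θ) θ
  hasDerivAt_snd : ∀ θ, HasDerivAt p (ρ θ - h θ) θ
  pos : ∀ θ, 0 < ρ θ
  periodic : Function.Periodic h (2 * π)
  periodic_snd : Function.Periodic p (2 * π)

theorem unitTangent_periodic : Function.Periodic unitTangent (2 * π) := fun θ => by
  simp [unitTangent]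

theorem norm_unitTangent (θ : ℝ) : ‖unitTangent θ‖ = 1 := by
  simp [unitTangent, EuclideanSpace.norm_eq, Fin.sum_univ_two]

theorem normalHeight_periodic (x : Plane) : Function.Periodic (normalHeight x) (2 * π) := fun θ => by
  simp [normalHeight]

theorem normalHeight_sub (x y : Plane) (θ : ℝ) :
    normalHeight (x - y) θ = normalHeight x θ - normalHeight y θ := by
  simp only [normalHeight, PiLp.sub_apply]; ring

theorem norm_sq_plane (x : Plane) : ‖x‖ ^ 2 = x 0 ^ 2 + x 1 ^ 2 := by
  simp [EuclideanSpace.norm_sq_eq, Fin.sum_univ_two]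

theorem hasDerivAt_plane {f : ℝ → Plane} {v : Plane} {θ : ℝ} :
    HasDerivAt f v θ ↔ ∀ i, HasDerivAt (fun u => f u i) (v i) θ := by
  rw [← hasDerivWithinAt_univ, hasDerivWithinAt_iff_hasFDerivWithinAt, hasFDerivWithinAt_euclidean]
  refine forall_congr' fun i => ?_
  rw [← hasDerivWithinAt_univ, hasDerivWithinAt_iff_hasFDerivWithinAt]
  exact iff_of_eq (congrArg (HasFDerivWithinAt _ · _ _) (by ext; simp))

theorem inner_unitTangent (x : Plane) (θ : ℝ) :
    inner ℝ x (unitTangent θ) = x 0 * cos θ + x 1 * sin θ := by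
  simp [unitTangent, PiLp.inner_apply, Fin.sum_univ_two, mul_comm]

theorem normalHeight_le_norm (x : Plane) (θ : ℝ) : normalHeight x θ ≤ ‖x‖ := by
  refine le_of_sq_le_sq ?_ (norm_nonneg x)
  rw [norm_sq_plane, normalHeight]
  nlinarith [sq_nonneg (x 0 * cos θ + x 1 * sin θ), sin_sq_add_cos_sq θ]

theorem hasDerivAt_normalHeight (x : Plane) (θ : ℝ) :
    HasDerivAt (normalHeight x) (inner ℝ x (unitTangent θ)) θ := by
  rw [inner_unitTangent]
  refine (((hasDerivAt_sin θ).const_mul (x 0)).sub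
    ((hasDerivAt_cos θ).const_mul (x 1))).congr_deriv ?_
  ring

theorem eq_of_normalHeight_eq {x y : Plane} {θ : ℝ} (hn : normalHeight x θ = normalHeight y θ)
    (ht : inner ℝ x (unitTangent θ) = inner ℝ y (unitTangent θ)) : x = y := by
  simp only [inner_unitTangent, normalHeight] at hn ht
  have := sin_sq_add_cos_sq θ
  ext i
  fin_cases i
  · simp only [Fin.zero_eta]
    linear_combination sin θ * hn + cos θ * ht + (y 0 - x 0) * this
  · simp only [Fin.mk_one]
    linear_combination sin θ * ht - cos θ * hn + (y 1 - x 1) * this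

theorem inner_of_angle_unitTangent_eq {x : Plane} {θ γ : ℝ} (h : angle x (unitTangent θ) = γ) :
    inner ℝ x (unitTangent θ) = ‖x‖ * cos γ := by
  rw [← h, mul_comm, ← cos_angle_mul_norm_mul_norm, norm_unitTangent, mul_one]

theorem angle_unitTangent_eq {x : Plane} {θ γ : ℝ} (hx : x ≠ 0) (h0 : 0 ≤ γ) (h1 : γ ≤ π)
    (h : inner ℝ x (unitTangent θ) = ‖x‖ * cos γ) : angle x (unitTangent θ) = γ := by
  rw [angle, h, norm_unitTangent, mul_one, mul_div_cancel_left₀ _ (norm_ne_zero_iff.2 hx),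
    arccos_cos h0 h1]

theorem normalHeight_supportCurve_self (h p : ℝ → ℝ) (θ : ℝ) :
    normalHeight (supportCurve h p θ) θ = h θ := by
  simp only [normalHeight, supportCurve, Matrix.cons_val_zero, Matrix.cons_val_one]
  linear_combination h θ * sin_sq_add_cos_sq θ

theorem inner_supportCurve_self (h p : ℝ → ℝ) (θ : ℝ) :
    inner ℝ (supportCurve h p θ) (unitTangent θ) = p θ := by
  simp only [inner_unitTangent, supportCurve, Matrix.cons_val_zero, Matrix.cons_val_one]
  linear_combination p θ * sin_sq_add_cos_sq θ

theorem normalHeight_add_smul (x y : Plane) (a b θ : ℝ) :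
    normalHeight (a • x + b • y) θ = a * normalHeight x θ + b * normalHeight y θ := by
  simp only [normalHeight, PiLp.add_apply, PiLp.smul_apply, smul_eq_mul]; ring

theorem isClosed_supportBody (h : ℝ → ℝ) : IsClosed (supportBody h) := by
  rw [supportBody, Set.ofPred_forall]
  refine isClosed_iInter fun θ => isClosed_le ?_ continuous_const
  unfold normalHeight
  fun_prop

theorem isCompact_supportBody (h : ℝ → ℝ) : IsCompact (supportBody h) := by
  refine Metric.isCompact_of_isClosed_isBounded (isClosed_supportBody h) ?_
  refine isBounded_iff_forall_norm_le.2
    ⟨(|h (π / 2)| + |h (-(π / 2))|) + (|h 0| + |h π|), fun x hx => ?_⟩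
  have e1 := hx (π / 2)
  have e2 := hx (-(π / 2))
  have e3 := hx 0
  have e4 := hx π
  simp [normalHeight] at e1 e2 e3 e4
  have b1 := le_abs_self (h (π / 2))
  have b2 := le_abs_self (h (-(π / 2)))
  have b3 := le_abs_self (h 0)
  have b4 := le_abs_self (h π)
  have c1 := abs_nonneg (h (π / 2))
  have c2 := abs_nonneg (h (-(π / 2)))
  have c3 := abs_nonneg (h 0)
  have c4 := abs_nonneg (h π)
  have a0 : |x 0| ≤ |h (π / 2)| + |h (-(π / 2))| := abs_le.2 ⟨by linarith, by linarith⟩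
  have a1 : |x 1| ≤ |h 0| + |h π| := abs_le.2 ⟨by linarith, by linarith⟩
  refine le_trans (le_of_sq_le_sq ?_ (by positivity) : ‖x‖ ≤ |x 0| + |x 1|) (add_le_add a0 a1)
  rw [norm_sq_plane, ← sq_abs (x 0), ← sq_abs (x 1)]
  nlinarith [abs_nonneg (x 0), abs_nonneg (x 1)]

theorem normalHeight_lt_of_mem_interior {h : ℝ → ℝ} {x : Plane}
    (hx : x ∈ interior (supportBody h)) (θ : ℝ) :
    normalHeight x θ < h θ := by
  by_contra! hle
  obtain ⟨ε, hε, hb⟩ := Metric.mem_nhds_iff.1 (mem_interior_iff_mem_nhds.1 hx)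
  have hn : ‖unitTangent (θ - π / 2)‖ = 1 := norm_unitTangent _
  have := hb (show x + (ε / 2) • unitTangent (θ - π / 2) ∈ Metric.ball x ε by
    rw [mem_ball_iff_norm, add_sub_cancel_left, norm_smul, hn, mul_one, Real.norm_eq_abs,
      abs_of_pos (by linarith)]
    linarith) θ
  simp [normalHeight, unitTangent, cos_sub_pi_div_two, sin_sub_pi_div_two] at this hle
  nlinarith [sin_sq_add_cos_sq θ]

/-- The chord between the points with tangent directions `m - γ` and `m + γ` has direction `m`. -/
theorem supportCurve_chord_eq (h p : ℝ → ℝ) {γ m : ℝ}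
    (hm : cos γ * (h (m + γ) - h (m - γ)) = sin γ * (p (m + γ) + p (m - γ))) :
    ∃ r : ℝ, supportCurve h p (m + γ) - supportCurve h p (m - γ) = r • unitTangent m := by
  refine ⟨inner ℝ (supportCurve h p (m + γ) - supportCurve h p (m - γ)) (unitTangent m),
    eq_of_normalHeight_eq (θ := m) ?_ ?_⟩
  · have := sin_sq_add_cos_sq m
    simp [normalHeight, supportCurve, unitTangent, cos_add, sin_add, cos_sub, sin_sub]
    linear_combination (cos γ * (h (m + γ) - h (m - γ)) - sin γ * (p (m + γ) + p (m - γ))) * this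
      + hm
  · rw [inner_smul_left, real_inner_self_eq_norm_sq, norm_unitTangent]
    simp

namespace IsSupportFunction

variable {h p ρ : ℝ → ℝ}

theorem supportCurve_periodic (H : IsSupportFunction h p ρ) :
    Function.Periodic (supportCurve h p) (2 * π) := fun θ => by
  simp [supportCurve, H.periodic θ, H.periodic_snd θ]

theorem hasDerivAt_supportCurve (H : IsSupportFunction h p ρ) (θ : ℝ) :
    HasDerivAt (supportCurve h p) (ρ θ • unitTangent θ) θ := by
  rw [hasDerivAt_plane]
  have hh := H.hasDerivAt θ
  have hp := H.hasDerivAt_snd θ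
  have hs := hasDerivAt_sin θ
  have hc := hasDerivAt_cos θ
  intro i
  fin_cases i
  · refine ((hh.mul hs).add (hp.mul hc)).congr_deriv ?_
    simp [unitTangent]; ring
  · refine ((hp.mul hs).sub (hh.mul hc)).congr_deriv ?_
    simp [unitTangent]; ring

theorem hasDerivAt_normalHeight_supportCurve (H : IsSupportFunction h p ρ) (θ φ : ℝ) :
    HasDerivAt (fun u => normalHeight (supportCurve h p u) θ) (-(ρ φ * sin (φ - θ))) φ := by
  have hd := hasDerivAt_plane.1 (H.hasDerivAt_supportCurve φ)
  refine (((hd 0).mul_const (sin θ)).sub ((hd 1).mul_const (cos θ))).congr_deriv ?_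
  simp [unitTangent, sin_sub]; ring

theorem normalHeight_lt_of_mem_Ioc (H : IsSupportFunction h p ρ)
    {θ φ : ℝ} (h0 : θ < φ) (h1 : φ ≤ θ + π) :
    normalHeight (supportCurve h p φ) θ < h θ := by
  have hanti : StrictAntiOn (fun u => normalHeight (supportCurve h p u) θ) (Set.Icc θ (θ + π)) := by
    refine strictAntiOn_of_deriv_neg (convex_Icc _ _)
      (fun u _ => (H.hasDerivAt_normalHeight_supportCurve θ u).continuousAt.continuousWithinAt) ?_
    intro u hu
    rw [interior_Icc] at hu
    rw [(H.hasDerivAt_normalHeight_supportCurve θ u).deriv]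
    exact neg_neg_of_pos (mul_pos (H.pos u)
      (sin_pos_of_pos_of_lt_pi (by linarith [hu.1]) (by linarith [hu.2])))
  have := hanti ⟨le_rfl, by linarith [pi_pos]⟩ ⟨h0.le, h1⟩ h0
  simpa only [normalHeight_supportCurve_self] using this

theorem normalHeight_lt_of_mem_Ico (H : IsSupportFunction h p ρ)
    {θ φ : ℝ} (h0 : θ - π ≤ φ) (h1 : φ < θ) :
    normalHeight (supportCurve h p φ) θ < h θ := by
  have hmono : StrictMonoOn (fun u => normalHeight (supportCurve h p u) θ)
      (Set.Icc (θ - π) θ) := by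
    refine strictMonoOn_of_deriv_pos (convex_Icc _ _)
      (fun u _ => (H.hasDerivAt_normalHeight_supportCurve θ u).continuousAt.continuousWithinAt) ?_
    intro u hu
    rw [interior_Icc] at hu
    rw [(H.hasDerivAt_normalHeight_supportCurve θ u).deriv]
    exact neg_pos_of_neg (mul_neg_of_pos_of_neg (H.pos u)
      (sin_neg_of_neg_of_neg_pi_lt (by linarith [hu.2]) (by linarith [hu.1])))
  have := hmono ⟨h0, h1.le⟩ ⟨by linarith [pi_pos], le_rfl⟩ h1
  simpa only [normalHeight_supportCurve_self] using this

theorem normalHeight_lt_or (H : IsSupportFunction h p ρ) (θ φ : ℝ) :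
    normalHeight (supportCurve h p φ) θ < h θ ∨ ∃ k : ℤ, φ + k • (2 * π) = θ := by
  obtain ⟨k, hk, -⟩ := existsUnique_add_zsmul_mem_Ico two_pi_pos φ (θ - π)
  rw [← H.supportCurve_periodic.zsmul k φ]
  rcases lt_trichotomy (φ + k • (2 * π)) θ with hlt | heq | hgt
  · exact .inl (H.normalHeight_lt_of_mem_Ico hk.1 hlt)
  · exact .inr ⟨k, heq⟩
  · exact .inl (H.normalHeight_lt_of_mem_Ioc hgt (by linarith [hk.2]))

theorem supportCurve_mem (H : IsSupportFunction h p ρ)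
    (φ : ℝ) : supportCurve h p φ ∈ supportBody h := fun θ => by
  rcases H.normalHeight_lt_or θ φ with hlt | ⟨k, rfl⟩
  · exact hlt.le
  · rw [← H.supportCurve_periodic.zsmul k φ, normalHeight_supportCurve_self]

theorem exists_add_zsmul_eq (H : IsSupportFunction h p ρ)
    {θ φ : ℝ} (he : supportCurve h p φ = supportCurve h p θ) :
    ∃ k : ℤ, φ + k • (2 * π) = θ := by
  refine (H.normalHeight_lt_or θ φ).resolve_left ?_
  rw [he, normalHeight_supportCurve_self]
  exact lt_irrefl _

theorem normalHeight_lt_of_ne (H : IsSupportFunction h p ρ)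
    {θ φ : ℝ} (he : supportCurve h p φ ≠ supportCurve h p θ) :
    normalHeight (supportCurve h p φ) θ < h θ := by
  refine (H.normalHeight_lt_or θ φ).resolve_right ?_
  rintro ⟨k, rfl⟩
  exact he (H.supportCurve_periodic.zsmul k φ).symm

theorem eq_supportCurve (H : IsSupportFunction h p ρ)
    {x : Plane} (hx : x ∈ supportBody h) {θ : ℝ}
    (he : normalHeight x θ = h θ) : x = supportCurve h p θ := by
  refine eq_of_normalHeight_eq (by rw [he, normalHeight_supportCurve_self]) ?_
  rw [inner_supportCurve_self]
  have hmin : IsLocalMin (fun u => h u - normalHeight x u) θ :=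
    Filter.Eventually.of_forall fun u => by simpa [he] using hx u
  have := hmin.hasDerivAt_eq_zero ((H.hasDerivAt θ).sub (hasDerivAt_normalHeight x θ))
  linarith

theorem mem_interior (H : IsSupportFunction h p ρ)
    {x : Plane} (hx : ∀ θ, normalHeight x θ < h θ) :
    x ∈ interior (supportBody h) := by
  have hcont : Continuous fun u => h u - normalHeight x u := continuous_iff_continuousAt.2
    fun u => ((H.hasDerivAt u).sub (hasDerivAt_normalHeight x u)).continuousAt
  obtain ⟨u, -, hu⟩ := (isCompact_Icc (a := (0 : ℝ)) (b := 2 * π)).exists_isMinOn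
    ⟨0, le_rfl, two_pi_pos.le⟩ hcont.continuousOn
  refine _root_.mem_interior.2 ⟨Metric.ball x (h u - normalHeight x u), fun y hy θ => ?_,
    Metric.isOpen_ball, Metric.mem_ball_self (sub_pos.2 (hx u))⟩
  obtain ⟨k, hk, -⟩ := existsUnique_add_zsmul_mem_Ico two_pi_pos θ 0
  simp only [zero_add] at hk
  have hmin : h u - normalHeight x u ≤ _ := hu (Set.Ico_subset_Icc_self hk)
  simp only [H.periodic.zsmul k θ, (normalHeight_periodic x).zsmul k θ] at hmin
  have hle := normalHeight_le_norm (y - x) θ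
  rw [normalHeight_sub] at hle
  rw [mem_ball_iff_norm] at hy
  linarith

theorem range_supportCurve (H : IsSupportFunction h p ρ) :
    Set.range (supportCurve h p) = frontier (supportBody h) := by
  rw [(isClosed_supportBody h).frontier_eq]
  ext x
  constructor
  · rintro ⟨θ, rfl⟩
    refine ⟨H.supportCurve_mem θ, fun hi => ?_⟩
    have := normalHeight_lt_of_mem_interior hi θ
    rw [normalHeight_supportCurve_self] at this
    exact lt_irrefl _ this
  · rintro ⟨hx, hi⟩
    by_contra hr
    refine hi (H.mem_interior fun θ => lt_of_le_of_ne (hx θ) fun he => hr ⟨θ, ?_⟩)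
    exact (H.eq_supportCurve hx he).symm

theorem strictConvex_supportBody (H : IsSupportFunction h p ρ) :
    StrictConvex ℝ (supportBody h) := by
  intro x hx y hy hxy a b ha hb hab
  refine H.mem_interior fun θ => ?_
  rw [normalHeight_add_smul]
  obtain hlt | hlt : normalHeight x θ < h θ ∨ normalHeight y θ < h θ := by
    by_contra! hc
    exact hxy ((H.eq_supportCurve hx ((hx θ).antisymm hc.1)).trans
      (H.eq_supportCurve hy ((hy θ).antisymm hc.2)).symm)
  · have := hy θ
    obtain rfl : b = 1 - a := by linarith
    nlinarith
  · have := hx θ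
    obtain rfl : b = 1 - a := by linarith
    nlinarith

theorem angle_chord (H : IsSupportFunction h p ρ) {γ : ℝ} (hγ0 : 0 < γ) (hγ1 : γ < π / 2)
    (hm : ∀ m, cos γ * (h (m + γ) - h (m - γ)) = sin γ * (p (m + γ) + p (m - γ)))
    {θ φ : ℝ} (hne : supportCurve h p θ ≠ supportCurve h p φ)
    (hang : angle (supportCurve h p φ - supportCurve h p θ) (unitTangent θ) = γ) :
    angle (supportCurve h p φ - supportCurve h p θ) (unitTangent φ) = γ := by
  have hsin : 0 < sin γ := sin_pos_of_pos_of_lt_pi hγ0 (by linarith)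
  have hD0 : supportCurve h p φ - supportCurve h p θ ≠ 0 := sub_ne_zero.2 hne.symm
  have hd : 0 < ‖supportCurve h p φ - supportCurve h p θ‖ := norm_pos_iff.2 hD0
  have hD : supportCurve h p φ - supportCurve h p θ =
      ‖supportCurve h p φ - supportCurve h p θ‖ • unitTangent (θ + γ) := by
    have hlt : normalHeight (supportCurve h p φ - supportCurve h p θ) θ < 0 := by
      rw [normalHeight_sub, normalHeight_supportCurve_self]
      linarith [H.normalHeight_lt_of_ne hne.symm]
    have hin := inner_of_angle_unitTangent_eq hang
    have hsq := norm_sq_plane (supportCurve h p φ - supportCurve h p θ)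
    generalize supportCurve h p φ - supportCurve h p θ = D at *
    have hc : normalHeight D θ = -(‖D‖ * sin γ) := by
      have h2 : normalHeight D θ ^ 2 = (‖D‖ * sin γ) ^ 2 := by
        rw [inner_unitTangent] at hin
        rw [normalHeight]
        linear_combination (-(D 0 * cos θ + D 1 * sin θ) - ‖D‖ * cos γ) * hin
          + (D 0 ^ 2 + D 1 ^ 2) * sin_sq_add_cos_sq θ - ‖D‖ ^ 2 * sin_sq_add_cos_sq γ - hsq
      rcases sq_eq_sq_iff_eq_or_eq_neg.1 h2 with h3 | h3
      · nlinarith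
      · exact h3
    refine eq_of_normalHeight_eq (θ := θ) ?_ ?_
    · rw [hc]
      simp [normalHeight, unitTangent, cos_add, sin_add]
      linear_combination (‖D‖ * sin γ) * sin_sq_add_cos_sq θ
    · rw [hin, inner_unitTangent]
      simp [unitTangent, cos_add, sin_add]
      linear_combination -(‖D‖ * cos γ) * sin_sq_add_cos_sq θ
  obtain ⟨r, hr⟩ := supportCurve_chord_eq h p (hm (θ + γ))
  rw [add_sub_cancel_right] at hr
  set d := ‖supportCurve h p φ - supportCurve h p θ‖ with hd_def
  have key : ∀ α, normalHeight (supportCurve h p φ) α - normalHeight (supportCurve h p θ) α =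
      d * sin (α - (θ + γ)) := fun α => by
    rw [← normalHeight_sub, hD, sin_sub]
    simp [normalHeight, unitTangent]
    ring
  have key' : ∀ α, normalHeight (supportCurve h p (θ + γ + γ)) α
      - normalHeight (supportCurve h p θ) α = r * sin (α - (θ + γ)) := fun α => by
    rw [← normalHeight_sub, hr, sin_sub]
    simp [normalHeight, unitTangent]
    ring
  rcases H.normalHeight_lt_or (θ + γ + γ) φ with hlt | ⟨k, hk⟩
  · exfalso
    have k1 := key (θ + γ + γ)
    have k2 := key' (θ + γ + γ)
    have k3 := key φ
    have k4 := key' φ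
    rw [normalHeight_supportCurve_self] at k2 k3
    rw [add_sub_cancel_left] at k1 k2
    have hdr : d < r := by nlinarith
    have l1 := H.normalHeight_lt_of_ne hne
    have l2 := H.supportCurve_mem (θ + γ + γ) φ
    have hs : 0 < sin (φ - (θ + γ)) := by
      by_contra! hc
      nlinarith
    nlinarith
  · refine angle_unitTangent_eq hD0 hγ0.le (by linarith) ?_
    rw [← unitTangent_periodic.zsmul k φ, hk, ← hd_def, hD, inner_unitTangent]
    have e : cos γ = cos (θ + γ + γ - (θ + γ)) := by rw [add_sub_cancel_left]
    rw [e, cos_sub]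
    simp [unitTangent]
    ring

end IsSupportFunction

/-- A smooth surjection of the line with positive derivative has a smooth inverse. -/
theorem exists_contDiff_inverse {σ ρ : ℝ → ℝ} (hσ : ContDiff ℝ (⊤ : ℕ∞) σ)
    (hd : ∀ u, HasDerivAt σ (ρ u) u) (hρ : ∀ u, 0 < ρ u) (hs : Function.Surjective σ) :
    ∃ τ : ℝ → ℝ, ContDiff ℝ (⊤ : ℕ∞) τ ∧ StrictMono τ ∧ (∀ s, σ (τ s) = s) ∧
      (∀ u, τ (σ u) = u) ∧ ∀ s, HasDerivAt τ (ρ (τ s))⁻¹ s := by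
  have hmono : StrictMono σ := strictMono_of_deriv_pos fun u => by rw [(hd u).deriv]; exact hρ u
  let e := hmono.orderIsoOfSurjective σ hs
  refine ⟨e.symm, ?_, e.symm.strictMono, e.apply_symm_apply, e.symm_apply_apply, fun s => ?_⟩
  · exact e.toHomeomorph.contDiff_symm_deriv (fun u => (hρ u).ne') hd hσ
  · exact HasDerivAt.of_local_left_inverse e.symm.continuous.continuousAt (hd _) (hρ _).ne'
      (Filter.Eventually.of_forall e.apply_symm_apply)

theorem isArclengthParam_supportCurve {h p ρ σ τ : ℝ → ℝ} {L : ℝ} (H : IsSupportFunction h p ρ)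
    (hL : 0 < L) (hC : ContDiff ℝ 1 (supportCurve h p ∘ τ))
    (hσ : ∀ u, σ (u + 2 * π) = σ u + L) (h0 : σ 0 = 0) (hmono : StrictMono τ)
    (hστ : ∀ s, σ (τ s) = s) (hτσ : ∀ u, τ (σ u) = u)
    (hd : ∀ s, HasDerivAt (supportCurve h p ∘ τ) (unitTangent (τ s)) s) :
    IsArclengthParam (supportBody h) (supportCurve h p ∘ τ) L where
  hL := hL
  contDiff := hC
  unitSpeed s := by rw [(hd s).deriv, norm_unitTangent]
  periodic s := by
    have : τ (s + L) = τ s + 2 * π := by rw [← hτσ (τ s + 2 * π), hσ, hστ]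
    simp only [Function.comp_apply, this, H.supportCurve_periodic (τ s)]
  injOn s hs t ht he := by
    have t0 : τ 0 = 0 := by simpa [h0] using hτσ 0
    have t1 : τ L = 2 * π := by rw [← hτσ (2 * π), ← zero_add (2 * π), hσ, h0, zero_add]
    have mem : ∀ u ∈ Set.Ico 0 L, τ u ∈ Set.Ico 0 (0 + 2 * π) := fun u hu => by
      rw [zero_add, ← t1]
      exact ⟨t0 ▸ hmono.monotone hu.1, hmono hu.2⟩
    obtain ⟨k, hk⟩ := H.exists_add_zsmul_eq he
    refine hmono.injective ?_
    have huniq := (existsUnique_add_zsmul_mem_Ico two_pi_pos (τ s) 0).unique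
      (y₁ := 0) (y₂ := k) (by simpa using mem s hs) (by simpa [← hk] using mem t ht)
    rw [← hk, ← huniq, zero_smul, add_zero]
  range_eq := by
    rw [(show Function.Surjective τ from fun u => ⟨σ u, hτσ u⟩).range_comp, H.range_supportCurve]

theorem trig_identity_of_tan_mul_eq {x γ : ℝ} (hγ0 : 0 < γ) (hγ1 : γ < π / 2) (hx : x ≠ 0)
    (h : tan (x * γ) = x * tan γ) : cos γ * sin (x * γ) = x * (sin γ * cos (x * γ)) := by
  have hc : cos γ ≠ 0 := (cos_pos_of_mem_Ioo ⟨by linarith, hγ1⟩).ne'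
  have hc' : cos (x * γ) ≠ 0 := fun h0 => by
    rw [tan_eq_sin_div_cos, h0, div_zero] at h
    exact (mul_ne_zero hx (tan_pos_of_pos_of_lt_pi_div_two hγ0 hγ1).ne') h.symm
  rw [tan_eq_sin_div_cos, tan_eq_sin_div_cos] at h
  field_simp at h
  linear_combination h

theorem isSupportFunction_cos (n : ℕ) (hn : n ≠ 0) :
    IsSupportFunction (fun θ => 1 - cos (n * θ) / (n : ℝ) ^ 2) (fun θ => sin (n * θ) / n)
      (fun θ => 1 + (1 - 1 / (n : ℝ) ^ 2) * cos (n * θ)) := by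
  have hn0 : (n : ℝ) ≠ 0 := Nat.cast_ne_zero.2 hn
  have hn1 : (1 : ℝ) ≤ n := Nat.one_le_cast.2 (Nat.one_le_iff_ne_zero.2 hn)
  have harg : ∀ θ : ℝ, HasDerivAt (fun u : ℝ => (n : ℝ) * u) n θ := fun θ => by
    simpa using (hasDerivAt_id θ).const_mul (n : ℝ)
  have hshift : ∀ θ : ℝ, (n : ℝ) * (θ + 2 * π) = n * θ + n * (2 * π) := fun θ => by ring
  refine ⟨fun θ => ?_, fun θ => ?_, fun θ => ?_, fun θ => ?_, fun θ => ?_⟩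
  · refine (((harg θ).cos.div_const ((n : ℝ) ^ 2)).const_sub 1).congr_deriv ?_
    field_simp
  · refine ((harg θ).sin.div_const (n : ℝ)).congr_deriv ?_
    field_simp
    ring
  · have h1 := neg_one_le_cos (n * θ)
    have h2 : 0 < 1 / (n : ℝ) ^ 2 := by positivity
    have h3 : 1 / (n : ℝ) ^ 2 ≤ 1 := by
      rw [div_le_one (by positivity)]
      exact one_le_pow₀ hn1
    nlinarith
  · simp only [hshift, cos_add_nat_mul_two_pi]
  · simp only [hshift, sin_add_nat_mul_two_pi]

theorem not_sphere_supportCurve_cos (n : ℕ) (hn : 2 ≤ n) :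
    ¬ ∃ (x₀ : Plane) (r : ℝ), ∀ θ, ‖supportCurve (fun θ => 1 - cos (n * θ) / (n : ℝ) ^ 2)
      (fun θ => sin (n * θ) / n) θ - x₀‖ = r := by
  rintro ⟨x₀, r, hr⟩
  have H := isSupportFunction_cos n (by lia)
  have hn2 : (2 : ℝ) ≤ n := by exact_mod_cast hn
  have hn0 : (n : ℝ) ≠ 0 := by positivity
  have ht : ∀ θ, sin (n * θ) / n = x₀ 0 * cos θ + x₀ 1 * sin θ := fun θ => by
    have hd := ((H.hasDerivAt_supportCurve θ).sub_const x₀).norm_sq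
    simp only [hr, real_inner_smul_right, inner_sub_left, ← mul_sub, inner_supportCurve_self] at hd
    have := hd.unique (hasDerivAt_const θ (r ^ 2))
    rw [inner_unitTangent] at this
    have hρ := (H.pos θ).ne'
    have h3 := (mul_eq_zero.1 ((mul_eq_zero.1 this).resolve_left two_ne_zero)).resolve_left hρ
    linarith
  have h0 : x₀ 0 = 0 := by simpa using (ht 0).symm
  have hd1 : HasDerivAt (fun θ : ℝ => sin (n * θ) / n) 1 0 := by
    have harg : HasDerivAt (fun u : ℝ => (n : ℝ) * u) n 0 := by
      simpa using (hasDerivAt_id (0 : ℝ)).const_mul (n : ℝ)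
    refine (harg.sin.div_const (n : ℝ)).congr_deriv ?_
    simp [hn0]
  have hd2 : HasDerivAt (fun θ : ℝ => sin (n * θ) / n) (x₀ 1) 0 := by
    simp only [ht, h0, zero_mul, zero_add]
    simpa using (hasDerivAt_sin 0).const_mul (x₀ 1)
  have h1 := hd2.unique hd1
  have := ht (π / 2)
  rw [h0, h1, sin_pi_div_two, zero_mul, zero_add, one_mul, div_eq_one_iff_eq hn0] at this
  linarith [sin_le_one (n * (π / 2))]

/-- for every `n ≥ 3` and `γ ∈ (0, π/2)` with `tan (n γ) = n tan γ`
there is a non-circular, compact, strictly convex plane body with `C^∞` boundary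
that floats in neutral equilibrium in every orientation at contact angle `π − γ`:
every directed chord making angle `γ` with the boundary at one endpoint makes
angle `γ` with the boundary at the other endpoint. -/
theorem exists_noncircular_floating_body (n : ℕ) (hn : 3 ≤ n) (γ : ℝ)
    (hγ0 : 0 < γ) (hγ1 : γ < π / 2) (hγ : Real.tan (n * γ) = n * Real.tan γ) :
    ∃ (Ω : Set Plane) (c : ℝ → Plane) (L : ℝ),
      IsCompact Ω ∧ StrictConvex ℝ Ω ∧ (interior Ω).Nonempty ∧
      IsArclengthParam Ω c L ∧ ContDiff ℝ (⊤ : ℕ∞) c ∧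
      (¬ ∃ (x₀ : Plane) (r : ℝ), 0 < r ∧ ∀ s : ℝ, ‖c s - x₀‖ = r) ∧
      ∀ s t : ℝ, c s ≠ c t →
        angle (c t - c s) (deriv c s) = γ →
        angle (c t - c s) (deriv c t) = γ := by
  have hn0 : (n : ℝ) ≠ 0 := by positivity
  have hn1 : (1 : ℝ) ≤ n := by exact_mod_cast (by lia : 1 ≤ n)
  have H := isSupportFunction_cos n (by lia)
  have htrig := trig_identity_of_tan_mul_eq hγ0 hγ1 hn0 hγ
  set h : ℝ → ℝ := fun θ => 1 - cos (n * θ) / (n : ℝ) ^ 2 with h_def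
  set p : ℝ → ℝ := fun θ => sin (n * θ) / n with p_def
  set ρ : ℝ → ℝ := fun θ => 1 + (1 - 1 / (n : ℝ) ^ 2) * cos (n * θ)
  let σ : ℝ → ℝ := fun θ => θ + (1 - 1 / (n : ℝ) ^ 2) * (sin (n * θ) / n)
  have hσ : ∀ θ, HasDerivAt σ (ρ θ) θ := fun θ => by
    refine ((hasDerivAt_id θ).add
      ((H.hasDerivAt_snd θ).const_mul (1 - 1 / (n : ℝ) ^ 2))).congr_deriv ?_
    simp only [ρ, h_def]
    field_simp
    ring
  have hσs : ContDiff ℝ (⊤ : ℕ∞) σ := by fun_prop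
  have hσp : ∀ u, σ (u + 2 * π) = σ u + 2 * π := fun u => by
    have := H.periodic_snd u
    simp only [p_def] at this
    simp only [σ, this]
    ring
  have hσsurj : Function.Surjective σ := by
    have hb : ∀ u, |(1 - 1 / (n : ℝ) ^ 2) * (sin (n * u) / n)| ≤ 1 := fun u => by
      have h2 : 0 < 1 / (n : ℝ) ^ 2 := by positivity
      have h3 : 1 / (n : ℝ) ^ 2 ≤ 1 := by
        rw [div_le_one (by positivity)]
        exact one_le_pow₀ hn1
      rw [abs_mul, abs_div, abs_of_nonneg (by linarith), abs_of_nonneg (by linarith : (0 : ℝ) ≤ n)]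
      refine mul_le_one₀ (by linarith) (by positivity) ?_
      exact div_le_one_of_le₀ ((abs_sin_le_one _).trans hn1) (by linarith)
    refine hσs.continuous.surjective ?_ ?_
    · exact Filter.tendsto_atTop_add_right_of_le _ (-1) Filter.tendsto_id
        fun u => (abs_le.1 (hb u)).1
    · exact Filter.tendsto_atBot_add_right_of_ge _ 1 Filter.tendsto_id
        fun u => (abs_le.1 (hb u)).2
  obtain ⟨τ, hτs, hmono, hστ, hτσ, hτ⟩ := exists_contDiff_inverse hσs hσ H.pos hσsurj
  have hC : ContDiff ℝ (⊤ : ℕ∞) (supportCurve h p ∘ τ) := by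
    refine ContDiff.comp ?_ hτs
    rw [contDiff_euclidean]
    intro i
    fin_cases i <;> simp [supportCurve, h_def, p_def] <;> fun_prop
  have hd : ∀ s, HasDerivAt (supportCurve h p ∘ τ) (unitTangent (τ s)) s := fun s => by
    refine ((H.hasDerivAt_supportCurve (τ s)).scomp s (hτ s)).congr_deriv ?_
    rw [smul_smul, inv_mul_cancel₀ (H.pos _).ne', one_smul]
  refine ⟨supportBody h, supportCurve h p ∘ τ, 2 * π, isCompact_supportBody h,
    H.strictConvex_supportBody, ⟨0, H.mem_interior fun θ => ?_⟩,
    isArclengthParam_supportCurve H two_pi_pos (hC.of_le (by exact_mod_cast le_top)) hσp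
      (by simp [σ]) hmono hστ hτσ hd, hC, ?_, fun s t hne hang => ?_⟩
  · have h3 : cos (n * θ) / (n : ℝ) ^ 2 < 1 := by
      rw [div_lt_one (by positivity)]
      have h4 : (3 : ℝ) ≤ n := by exact_mod_cast hn
      nlinarith [cos_le_one (n * θ)]
    simpa [normalHeight, h_def] using h3
  · rintro ⟨x₀, r, -, hr⟩
    refine not_sphere_supportCurve_cos n (by lia) ⟨x₀, r, fun θ => ?_⟩
    simpa [hτσ] using hr (σ θ)
  · rw [(hd s).deriv] at hang
    rw [(hd t).deriv]
    refine H.angle_chord hγ0 hγ1 (fun m => ?_) hne hang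
    simp only [h_def, p_def, mul_add, mul_sub, cos_add, cos_sub, sin_add, sin_sub]
    field_simp
    linear_combination (2 * sin (n * m)) * htrig
end
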